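/- For any bounded measurable function φ on X: N·var(γ_n^N(φ)/γ_n(1)) → Σ_{p=0}^n c_p^{−1} v_{p,n}(φ) as N → ∞, and N·E[(η_n^N(φ) − η_n(φ))²] → Σ_{p=0}^n c_p^{−1} v_{p,n}(φ − η_n(φ)) as N → ∞. -/

import Mathlib

open MeasureTheory ProbabilityTheory Filter
open scoped ENNReal NNReal Classical

noncomputable section

namespace PFVar

variable {X : Type*} [MeasurableSpace X]

/-- The unnormalized Feynman–Kac measures `γ_p`. -/
def gammaFK (M0 : Measure X) (M : ℕ → Kernel X X) (G : ℕ → X → ℝ) : ℕ → Measure X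
  | 0 => M0
  | p + 1 =>
      ((gammaFK M0 M G p).withDensity fun x => ENNReal.ofReal (G p x)).bind
        (fun x => M (p + 1) x)

/-- `γ_n(φ)`. -/
def gInt (M0 : Measure X) (M : ℕ → Kernel X X) (G : ℕ → X → ℝ) (n : ℕ) (φ : X → ℝ) : ℝ :=
  ∫ x, φ x ∂(gammaFK M0 M G n)

/-- `η_n(φ) = γ_n(φ)/γ_n(1)`. -/
def eInt (M0 : Measure X) (M : ℕ → Kernel X X) (G : ℕ → X → ℝ) (n : ℕ) (φ : X → ℝ) : ℝ :=
  gInt M0 M G n φ / gInt M0 M G n 1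

/-- Law of the path `(X_0,…,X_k)` of an inhomogeneous Markov chain with initial law `μ0` and
transitions `κ`, recorded as an element of `ℕ → Y` (coordinates beyond `k` are junk). -/
def markovPath {Y : Type*} [MeasurableSpace Y] (μ0 : Measure Y) (κ : ℕ → Y → Measure Y) :
    ℕ → Measure (ℕ → Y)
  | 0 => μ0.map fun y _ => y
  | k + 1 =>
      (markovPath μ0 κ k).bind fun ω =>
        (κ (k + 1) (ω k)).map fun y => Function.update ω (k + 1) y

/-- Categorical distribution on `{0,…,m−1} ⊆ ℕ` with weights `w`. -/
def cat (m : ℕ) (w : ℕ → ℝ) : Measure ℕ :=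
  (∑ j ∈ Finset.range m, ENNReal.ofReal (w j))⁻¹ •
    ∑ j ∈ Finset.range m, ENNReal.ofReal (w j) • Measure.dirac j

/-- Uniform distribution on `{0,…,m−1}`. -/
def unif (m : ℕ) : Measure ℕ := cat m fun _ => 1

/-- Extend a finite tuple to `ℕ` with junk values. -/
def padF {Y : Type*} [Nonempty Y] {m : ℕ} (f : Fin m → Y) : ℕ → Y := fun i =>
  if h : i < m then f ⟨i, h⟩ else Classical.arbitrary Y

/-- One resampling/mutation step of the particle filter: given the time-`p` configuration `z`,
the joint law of the ancestor indices `A_p` and the time-`p+1` particle configuration;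
each of the `Np (p+1)` new particles independently draws an ancestor from the categorical
distribution with weights `G p (z j)`, `j < Np p`, and then moves according to `M (p+1)`. -/
def pfStep [Nonempty X] (M : ℕ → Kernel X X) (G : ℕ → X → ℝ) (Np : ℕ → ℕ) (p : ℕ)
    (z : ℕ → X) : Measure ((ℕ → ℕ) × (ℕ → X)) :=
  (Measure.pi fun _ : Fin (Np (p + 1)) =>
      (cat (Np p) fun j => G p (z j)).bind fun a =>
        (M (p + 1) (z a)).map fun x => (a, x)).map fun f =>
    (padF fun i => (f i).1, padF fun i => (f i).2)

/-- The law of the particle system `(ζ, A)` run up to time `k`: the first component is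
`ζ : time → particle index → X`, the second is `A : time → particle index → ℕ`, where
`A p i` is the ancestor index of particle `i` of generation `p+1`. -/
def pfLaw [Nonempty X] (M0 : Measure X) (M : ℕ → Kernel X X) (G : ℕ → X → ℝ)
    (Np : ℕ → ℕ) : ℕ → Measure ((ℕ → ℕ → X) × (ℕ → ℕ → ℕ))
  | 0 =>
      (Measure.pi fun _ : Fin (Np 0) => M0).map fun f =>
        (fun p => if p = 0 then padF f else fun _ => Classical.arbitrary X, fun _ _ => 0)
  | k + 1 =>
      (pfLaw M0 M G Np k).bind fun ω =>
        (pfStep M G Np k (ω.1 k)).map fun az =>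
          (Function.update ω.1 (k + 1) az.2, Function.update ω.2 k az.1)

/-- Eve indices: `eve A 0 i = i` and `eve A (p+1) i = eve A p (A p i)`. -/
def eve (A : ℕ → ℕ → ℕ) : ℕ → ℕ → ℕ
  | 0 => fun i => i
  | p + 1 => fun i => eve A p (A p i)

/-- `η_n^N(φ)`. -/
def etaN (Np : ℕ → ℕ) (n : ℕ) (φ : X → ℝ) (ω : (ℕ → ℕ → X) × (ℕ → ℕ → ℕ)) : ℝ :=
  (Np n : ℝ)⁻¹ * ∑ i ∈ Finset.range (Np n), φ (ω.1 n i)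

/-- `γ_n^N(φ)`. -/
def gammaN (G : ℕ → X → ℝ) (Np : ℕ → ℕ) (n : ℕ) (φ : X → ℝ)
    (ω : (ℕ → ℕ → X) × (ℕ → ℕ → ℕ)) : ℝ :=
  (∏ p ∈ Finset.range n, etaN Np p (G p) ω) * etaN Np n φ ω

/-- The variance estimator `V_n^N(φ)`. -/
def Vest (Np : ℕ → ℕ) (n : ℕ) (φ : X → ℝ) (ω : (ℕ → ℕ → X) × (ℕ → ℕ → ℕ)) : ℝ :=
  etaN Np n φ ω ^ 2 -
    (∏ p ∈ Finset.range n, (Np p : ℝ) / ((Np p : ℝ) - 1)) *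
      ((Np n : ℝ) * ((Np n : ℝ) - 1))⁻¹ *
      ∑ i ∈ Finset.range (Np n), ∑ j ∈ Finset.range (Np n),
        if eve ω.2 n i ≠ eve ω.2 n j then φ (ω.1 n i) * φ (ω.1 n j) else 0

/-- Initial law of the doubled chain used to define `μ_b`. -/
def pairInit (M0 : Measure X) (b : ℕ → Bool) : Measure (X × X) :=
  if b 0 then M0.map fun x => (x, x) else M0.prod M0

/-- Transitions of the doubled chain used to define `μ_b`. -/
def pairKer (M : ℕ → Kernel X X) (b : ℕ → Bool) (p : ℕ) (q : X × X) : Measure (X × X) :=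
  if b p then (M p q.1).map fun y => (y, y) else (M p q.1).prod (M p q.2)

/-- `μ_b(φ) = E_b[φ(X_n, X_n') ∏_{p<n} G_p(X_p) G_p(X_p')]`. -/
def muB (M0 : Measure X) (M : ℕ → Kernel X X) (G : ℕ → X → ℝ) (n : ℕ) (b : ℕ → Bool)
    (φ : X × X → ℝ) : ℝ :=
  ∫ ω, φ (ω n) * ∏ p ∈ Finset.range n, G p (ω p).1 * G p (ω p).2
    ∂(markovPath (pairInit M0 b) (pairKer M b) n)

/-- `φ ⊗ φ`. -/
def tens (φ : X → ℝ) : X × X → ℝ := fun q => φ q.1 * φ q.2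

/-- The binary string `e_p`. -/
def eVec (p : ℕ) : ℕ → Bool := fun q => q == p

/-- The zero binary string `0_n`. -/
def zeroVec : ℕ → Bool := fun _ => false

/-- Extension of a finite binary string to `ℕ → Bool`. -/
def extB (n : ℕ) (b : Fin (n + 1) → Bool) : ℕ → Bool := fun p =>
  if h : p < n + 1 then b ⟨p, h⟩ else false

/-- `v_{p,n}(φ) = (μ_{e_p}(φ⊗φ) − μ_{0_n}(φ⊗φ)) / γ_n(1)²`. -/
def vpn (M0 : Measure X) (M : ℕ → Kernel X X) (G : ℕ → X → ℝ) (n p : ℕ) (φ : X → ℝ) : ℝ :=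
  (muB M0 M G n (eVec p) (tens φ) - muB M0 M G n zeroVec (tens φ)) / gInt M0 M G n 1 ^ 2

/-- `σ_n²(φ) = Σ_{p=0}^n c_p⁻¹ v_{p,n}(φ)`. -/
def sigma2 (M0 : Measure X) (M : ℕ → Kernel X X) (G : ℕ → X → ℝ) (c : ℕ → ℝ) (n : ℕ)
    (φ : X → ℝ) : ℝ :=
  ∑ p ∈ Finset.range (n + 1), (c p)⁻¹ * vpn M0 M G n p φ

/-- Particle numbers `N_p = ⌈c_p N⌉`. -/
def npart (c : ℕ → ℝ) (N : ℕ) (p : ℕ) : ℕ := ⌈c p * (N : ℝ)⌉₊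

/-- Backward tracing: `traceAux A n kn j = K_{n-j}` where `K_n = kn`, `K_p = A p (K_{p+1})`. -/
def traceAux (A : ℕ → ℕ → ℕ) (n kn : ℕ) : ℕ → ℕ
  | 0 => kn
  | j + 1 => A (n - (j + 1)) (traceAux A n kn j)

/-- The deterministic ancestral trace `K¹`: `trace A n kn p = K_p¹` given `K_n¹ = kn`. -/
def trace (A : ℕ → ℕ → ℕ) (n kn : ℕ) : ℕ → ℕ := fun p => traceAux A n kn (n - p)

/-- Conditional law of the broken-lineage trace `(K_0²,…,K_p²)` given `K_p² = v`
(entries above `p` are junk, to be overwritten). -/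
def k2Law (G : ℕ → X → ℝ) (Np : ℕ → ℕ) (ω : (ℕ → ℕ → X) × (ℕ → ℕ → ℕ)) (K1 : ℕ → ℕ) :
    ℕ → ℕ → Measure (ℕ → ℕ)
  | 0 => fun v => Measure.dirac fun q => if q = 0 then v else 0
  | p + 1 => fun v =>
      ((if v = K1 (p + 1) then cat (Np p) fun j => G p (ω.1 p j)
          else Measure.dirac (ω.2 p v)).bind fun w =>
        (k2Law G Np ω K1 p w).map fun f => Function.update f (p + 1) v)

/-- Conditional law of `(K¹, K²)` given the particle system `ω = (ζ, A)`. -/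
def kLaw (G : ℕ → X → ℝ) (Np : ℕ → ℕ) (n : ℕ) (ω : (ℕ → ℕ → X) × (ℕ → ℕ → ℕ)) :
    Measure ((ℕ → ℕ) × (ℕ → ℕ)) :=
  (unif (Np n)).bind fun k1n =>
    (unif (Np n)).bind fun k2n =>
      (k2Law G Np ω (trace ω.2 n k1n) n k2n).map fun k2 => (trace ω.2 n k1n, k2)

/-- Joint law of the particle system together with the tracing variables `(K¹, K²)`. -/
def pfkLaw [Nonempty X] (M0 : Measure X) (M : ℕ → Kernel X X) (G : ℕ → X → ℝ)
    (Np : ℕ → ℕ) (n : ℕ) :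
    Measure (((ℕ → ℕ → X) × (ℕ → ℕ → ℕ)) × ((ℕ → ℕ) × (ℕ → ℕ))) :=
  (pfLaw M0 M G Np n).bind fun ω => (kLaw G Np n ω).map fun k => (ω, k)

/-- `(k¹, k²) ∈ I(b)`. -/
def inI (Np : ℕ → ℕ) (n : ℕ) (b : ℕ → Bool) (k : (ℕ → ℕ) × (ℕ → ℕ)) : Prop :=
  ∀ p ≤ n, k.1 p < Np p ∧ k.2 p < Np p ∧ (k.1 p = k.2 p ↔ b p = true)

/-- The particle approximation `μ_b^N(φ)` (a function of the realization `ω = (ζ, A)`);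
the conditional expectation given `(A, ζ)` is the integral with respect to `kLaw`. -/
def muBN (G : ℕ → X → ℝ) (Np : ℕ → ℕ) (n : ℕ) (b : ℕ → Bool) (φ : X × X → ℝ)
    (ω : (ℕ → ℕ → X) × (ℕ → ℕ → ℕ)) : ℝ :=
  (∏ p ∈ Finset.range (n + 1),
      if b p then (Np p : ℝ) else (Np p : ℝ) / ((Np p : ℝ) - 1)) *
    gammaN G Np n 1 ω ^ 2 *
    ∫ k, (if inI Np n b k then (1 : ℝ) else 0) * φ (ω.1 n (k.1 n), ω.1 n (k.2 n))
      ∂(kLaw G Np n ω)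

/-- `v_{p,n}^N(φ)`. -/
def vpnN (G : ℕ → X → ℝ) (Np : ℕ → ℕ) (n p : ℕ) (φ : X → ℝ)
    (ω : (ℕ → ℕ → X) × (ℕ → ℕ → ℕ)) : ℝ :=
  (muBN G Np n (eVec p) (tens φ) ω - muBN G Np n zeroVec (tens φ) ω) / gammaN G Np n 1 ω ^ 2

/-- `v_n^N(φ) = Σ_{p=0}^n c_p⁻¹ v_{p,n}^N(φ)`. -/
def vnN (G : ℕ → X → ℝ) (Np : ℕ → ℕ) (c : ℕ → ℝ) (n : ℕ) (φ : X → ℝ)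
    (ω : (ℕ → ℕ → X) × (ℕ → ℕ → ℕ)) : ℝ :=
  ∑ p ∈ Finset.range (n + 1), (c p)⁻¹ * vpnN G Np n p φ ω

/-- `QAux M G n φ j = Q_{n-j,n}(φ)`. -/
def QAux (M : ℕ → Kernel X X) (G : ℕ → X → ℝ) (n : ℕ) (φ : X → ℝ) : ℕ → X → ℝ
  | 0 => φ
  | j + 1 => fun x => G (n - (j + 1)) x * ∫ y, QAux M G n φ j y ∂(M (n - j) x)

/-- `Q_{p,n}(φ)` where `Q_p(x, dx') = G_{p-1}(x) M_p(x, dx')`, `Q_{n,n} = Id`,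
`Q_{p,n} = Q_{p+1} ⋯ Q_n`. -/
def Qpn (M : ℕ → Kernel X X) (G : ℕ → X → ℝ) (n p : ℕ) (φ : X → ℝ) : X → ℝ :=
  QAux M G n φ (n - p)

/-- `φ̂ = G_n · φ`. -/
def hatf (G : ℕ → X → ℝ) (n : ℕ) (φ : X → ℝ) : X → ℝ := fun x => G n x * φ x

/-- `γ̂_n(φ) = γ_n(G_n φ)`. -/
def gHatInt (M0 : Measure X) (M : ℕ → Kernel X X) (G : ℕ → X → ℝ) (n : ℕ) (φ : X → ℝ) : ℝ :=
  gInt M0 M G n (hatf G n φ)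

/-- `η̂_n(φ) = γ̂_n(φ)/γ̂_n(1)`. -/
def eHatInt (M0 : Measure X) (M : ℕ → Kernel X X) (G : ℕ → X → ℝ) (n : ℕ) (φ : X → ℝ) : ℝ :=
  gHatInt M0 M G n φ / gHatInt M0 M G n 1

/-- `γ̂_n^N(φ) = γ_n^N(G_n φ)`. -/
def gammaHatN (G : ℕ → X → ℝ) (Np : ℕ → ℕ) (n : ℕ) (φ : X → ℝ)
    (ω : (ℕ → ℕ → X) × (ℕ → ℕ → ℕ)) : ℝ :=
  gammaN G Np n (hatf G n φ) ω

/-- `η̂_n^N(φ) = γ̂_n^N(φ)/γ̂_n^N(1)`. -/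
def etaHatN (G : ℕ → X → ℝ) (Np : ℕ → ℕ) (n : ℕ) (φ : X → ℝ)
    (ω : (ℕ → ℕ → X) × (ℕ → ℕ → ℕ)) : ℝ :=
  gammaHatN G Np n φ ω / gammaHatN G Np n 1 ω

/-- `v̂_{p,n}(φ) = v_{p,n}(φ̂)/η_n(G_n)²`. -/
def vpnHat (M0 : Measure X) (M : ℕ → Kernel X X) (G : ℕ → X → ℝ) (n p : ℕ) (φ : X → ℝ) : ℝ :=
  vpn M0 M G n p (hatf G n φ) / eInt M0 M G n (G n) ^ 2

/-- `σ̂_n²(φ) = Σ_{p=0}^n c_p⁻¹ v̂_{p,n}(φ)`. -/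
def sigma2Hat (M0 : Measure X) (M : ℕ → Kernel X X) (G : ℕ → X → ℝ) (c : ℕ → ℝ) (n : ℕ)
    (φ : X → ℝ) : ℝ :=
  ∑ p ∈ Finset.range (n + 1), (c p)⁻¹ * vpnHat M0 M G n p φ

/-- `V̂_n^N(φ) = V_n^N(φ̂)/η_n^N(G_n)²`. -/
def VestHat (G : ℕ → X → ℝ) (Np : ℕ → ℕ) (n : ℕ) (φ : X → ℝ)
    (ω : (ℕ → ℕ → X) × (ℕ → ℕ → ℕ)) : ℝ :=
  Vest Np n (hatf G n φ) ω / etaN Np n (G n) ω ^ 2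

/-- `v̂_{p,n}^N(φ) = v_{p,n}^N(φ̂)/η_n^N(G_n)²`. -/
def vpnHatN (G : ℕ → X → ℝ) (Np : ℕ → ℕ) (n p : ℕ) (φ : X → ℝ)
    (ω : (ℕ → ℕ → X) × (ℕ → ℕ → ℕ)) : ℝ :=
  vpnN G Np n p (hatf G n φ) ω / etaN Np n (G n) ω ^ 2

/-- `v̂_n^N(φ) = Σ_{p=0}^n c_p⁻¹ v̂_{p,n}^N(φ)`. -/
def vnHatN (G : ℕ → X → ℝ) (Np : ℕ → ℕ) (c : ℕ → ℝ) (n : ℕ) (φ : X → ℝ)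
    (ω : (ℕ → ℕ → X) × (ℕ → ℕ → ℕ)) : ℝ :=
  ∑ p ∈ Finset.range (n + 1), (c p)⁻¹ * vpnHatN G Np n p φ ω


open PFVar MeasureTheory ProbabilityTheory Filter

/-- Bounded measurable real-valued functions. -/
def BddMeas {Y : Type*} [MeasurableSpace Y] (f : Y → ℝ) : Prop :=
  Measurable f ∧ ∃ C, ∀ y, |f y| ≤ C

namespace BddMeas

variable {Y Z : Type*} [MeasurableSpace Y] [MeasurableSpace Z] {f g : Y → ℝ}

lemma exists_nonneg (hf : BddMeas f) : ∃ C, 0 ≤ C ∧ ∀ y, |f y| ≤ C := by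
  obtain ⟨-, C, hC⟩ := hf
  exact ⟨|C|, abs_nonneg C, fun y => (hC y).trans (le_abs_self C)⟩

lemma integrable (hf : BddMeas f) (μ : Measure Y) [IsFiniteMeasure μ] : Integrable f μ := by
  obtain ⟨hm, C, hC⟩ := hf
  exact Integrable.of_bound hm.aestronglyMeasurable C (ae_of_all _ hC)

lemma const (a : ℝ) : BddMeas fun _ : Y => a := ⟨measurable_const, |a|, fun _ => le_rfl⟩

lemma comp (hf : BddMeas f) {k : Z → Y} (hk : Measurable k) : BddMeas fun z => f (k z) :=
  ⟨hf.1.comp hk, hf.2.imp fun _ hC z => hC (k z)⟩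

lemma mul (hf : BddMeas f) (hg : BddMeas g) : BddMeas fun y => f y * g y := by
  obtain ⟨C, hC0, hC⟩ := hf.exists_nonneg
  obtain ⟨D, hD⟩ := hg.2
  refine ⟨hf.1.mul hg.1, C * D, fun y => ?_⟩
  rw [abs_mul]
  exact mul_le_mul (hC y) (hD y) (abs_nonneg _) hC0

lemma add (hf : BddMeas f) (hg : BddMeas g) : BddMeas fun y => f y + g y := by
  obtain ⟨C, hC⟩ := hf.2
  obtain ⟨D, hD⟩ := hg.2
  exact ⟨hf.1.add hg.1, C + D, fun y => (abs_add_le _ _).trans (add_le_add (hC y) (hD y))⟩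

lemma sub (hf : BddMeas f) (hg : BddMeas g) : BddMeas fun y => f y - g y := by
  simpa [sub_eq_add_neg] using hf.add ((const (-1)).mul hg)

lemma pow (hf : BddMeas f) (k : ℕ) : BddMeas fun y => f y ^ k := by
  induction k with
  | zero => simpa using const (1 : ℝ)
  | succ k ih => simpa [pow_succ] using ih.mul hf

lemma sum {ι : Type*} (s : Finset ι) {F : ι → Y → ℝ} (hF : ∀ i ∈ s, BddMeas (F i)) :
    BddMeas fun y => ∑ i ∈ s, F i y := by
  induction s using Finset.induction_on with
  | empty => simpa using const (0 : ℝ)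
  | insert i s hi ih =>
    simp only [Finset.sum_insert hi]
    exact (hF i (by simp)).add (ih fun j hj => hF j (by simp [hj]))

lemma prod {ι : Type*} (s : Finset ι) {F : ι → Y → ℝ} (hF : ∀ i ∈ s, BddMeas (F i)) :
    BddMeas fun y => ∏ i ∈ s, F i y := by
  induction s using Finset.induction_on with
  | empty => simpa using const (1 : ℝ)
  | insert i s hi ih =>
    simp only [Finset.prod_insert hi]
    exact (hF i (by simp)).mul (ih fun j hj => hF j (by simp [hj]))

lemma integral_add (hf : BddMeas f) (hg : BddMeas g) (μ : Measure Y) [IsFiniteMeasure μ] :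
    ∫ y, (f y + g y) ∂μ = ∫ y, f y ∂μ + ∫ y, g y ∂μ :=
  MeasureTheory.integral_add (hf.integrable μ) (hg.integrable μ)

lemma integral_sub (hf : BddMeas f) (hg : BddMeas g) (μ : Measure Y) [IsFiniteMeasure μ] :
    ∫ y, (f y - g y) ∂μ = ∫ y, f y ∂μ - ∫ y, g y ∂μ :=
  MeasureTheory.integral_sub (hf.integrable μ) (hg.integrable μ)

lemma integral_mono (hf : BddMeas f) (hg : BddMeas g) (hle : ∀ y, f y ≤ g y) (μ : Measure Y)
    [IsFiniteMeasure μ] : ∫ y, f y ∂μ ≤ ∫ y, g y ∂μ :=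
  MeasureTheory.integral_mono (hf.integrable μ) (hg.integrable μ) hle

lemma integral_family {κ : Z → Measure Y} (hκ : Measurable κ)
    (hp : ∀ z, IsProbabilityMeasure (κ z)) (hf : BddMeas f) : BddMeas fun z => ∫ y, f y ∂κ z := by
  obtain ⟨C, hC⟩ := hf.2
  let κ' : Kernel Z Y := ⟨κ, hκ⟩
  have : IsMarkovKernel κ' := ⟨hp⟩
  refine ⟨(hf.1.stronglyMeasurable.integral_kernel (κ := κ')).measurable, C, fun z => ?_⟩
  have := norm_integral_le_of_norm_le_const (μ := κ z) (f := f) (C := C) (ae_of_all _ hC)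
  simpa using this

end BddMeas

section Families

variable {A B D : Type*} [MeasurableSpace A] [MeasurableSpace B] [MeasurableSpace D]

lemma isProbabilityMeasure_bind {μ : Measure A} [IsProbabilityMeasure μ] {κ : A → Measure B}
    (hκ : Measurable κ) (hp : ∀ a, IsProbabilityMeasure (κ a)) :
    IsProbabilityMeasure (μ.bind κ) :=
  ⟨by simp [Measure.bind_apply .univ hκ.aemeasurable]⟩

lemma integral_bind {μ : Measure A} [IsFiniteMeasure μ] {κ : A → Measure B} (hκ : Measurable κ)
    (hp : ∀ a, IsProbabilityMeasure (κ a)) {f : B → ℝ} (hf : BddMeas f) :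
    ∫ b, f b ∂(μ.bind κ) = ∫ a, ∫ b, f b ∂κ a ∂μ := by
  let κ' : Kernel A B := ⟨κ, hκ⟩
  have : IsMarkovKernel κ' := ⟨hp⟩
  have h := Kernel.integral_comp (η := κ') (κ := Kernel.const Unit μ) (a := ())
    (hf.integrable _)
  simp only [Kernel.comp_apply, Kernel.const_apply] at h
  exact h

lemma measurable_map_family {κ : A → Measure B} (hκ : Measurable κ)
    (hp : ∀ a, IsProbabilityMeasure (κ a)) {g : A → B → D}
    (hg : Measurable fun q : A × B => g q.1 q.2) : Measurable fun a => (κ a).map (g a) := by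
  let κ' : Kernel A B := ⟨κ, hκ⟩
  have : IsMarkovKernel κ' := ⟨hp⟩
  refine Measure.measurable_of_measurable_coe _ fun s hs => ?_
  have h := Kernel.measurable_kernel_prodMk_left (κ := κ') (hg hs)
  convert h using 2 with a
  have hga : Measurable (g a) := hg.comp (measurable_prodMk_left (x := a))
  rw [Measure.map_apply hga hs]
  rfl

lemma measurable_pi_family {ι : Type*} [Fintype ι] {κ : A → Measure B} (hκ : Measurable κ)
    (hp : ∀ a, IsProbabilityMeasure (κ a)) :
    Measurable fun a => Measure.pi fun _ : ι => κ a := by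
  refine Measurable.measure_of_isPiSystem_of_isProbabilityMeasure generateFrom_pi.symm
    isPiSystem_pi ?_
  rintro _ ⟨s, hs, rfl⟩
  simp only [Measure.pi_pi]
  exact Finset.measurable_prod _ fun i _ =>
    (Measure.measurable_coe (hs i (Set.mem_univ i))).comp hκ

end Families

section Moments

lemma bddMeas_sum_eval {E ι : Type*} [MeasurableSpace E] {h : E → ℝ} (hh : BddMeas h)
    (s : Finset ι) : BddMeas fun x : ι → E => ∑ j ∈ s, h (x j) :=
  BddMeas.sum _ fun j _ => hh.comp (measurable_pi_apply j)

variable {E ι : Type*} [MeasurableSpace E] [Fintype ι] (ν : Measure E) [IsProbabilityMeasure ν]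
  {h : E → ℝ}

lemma integral_pi_eval (hh : Measurable h) (i : ι) :
    ∫ x, h (x i) ∂(Measure.pi fun _ : ι => ν) = ∫ e, h e ∂ν := by
  have e := integral_map (μ := Measure.pi fun _ : ι => ν)
    (measurable_pi_apply i).aemeasurable hh.aestronglyMeasurable
  exact e.symm.trans
    (congrArg (fun μ => ∫ y, h y ∂μ) (measurePreserving_eval (fun _ : ι => ν) i).map_eq)

lemma integral_sum_pow_mul_pow (hh : Measurable h) {s : Finset ι} {i : ι} (hi : i ∉ s) (j l : ℕ) :
    ∫ x, (∑ k ∈ s, h (x k)) ^ j * h (x i) ^ l ∂(Measure.pi fun _ : ι => ν) =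
      (∫ x, (∑ k ∈ s, h (x k)) ^ j ∂(Measure.pi fun _ : ι => ν)) * ∫ e, h e ^ l ∂ν := by
  have hm : ∀ k : ι, Measurable fun x : ι → E => h (x k) :=
    fun k => hh.comp (measurable_pi_apply k)
  have hind : iIndepFun (fun (k : ι) (x : ι → E) => h (x k)) (Measure.pi fun _ : ι => ν) :=
    iIndepFun_pi fun _ => hh.aemeasurable
  have h2 := (hind.indepFun_finsetSum_of_notMem hm hi).comp
    (φ := fun t => t ^ j) (ψ := fun t => t ^ l) (by fun_prop) (by fun_prop)
  have hs : Measurable fun x : ι → E => ∑ k ∈ s, h (x k) :=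
    Finset.measurable_sum _ fun k _ => hm k
  have h3 := h2.integral_fun_mul_eq_mul_integral
    ((Measurable.pow_const (by simpa [Finset.sum_fn] using hs) j).aestronglyMeasurable)
    (((hm i).pow_const l).aestronglyMeasurable)
  rw [← integral_pi_eval ν (hh.pow_const l) i]
  simpa [Function.comp_def] using h3

lemma integral_sum_eq_zero (hh : BddMeas h) (h0 : ∫ e, h e ∂ν = 0) (s : Finset ι) :
    ∫ x, ∑ j ∈ s, h (x j) ∂(Measure.pi fun _ : ι => ν) = 0 := by
  rw [integral_finsetSum _ fun j _ => (hh.comp (measurable_pi_apply j)).integrable _]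
  exact Finset.sum_eq_zero fun j _ => by rw [integral_pi_eval ν hh.1, h0]

lemma integral_sum_sq (hh : BddMeas h) (h0 : ∫ e, h e ∂ν = 0) (s : Finset ι) :
    ∫ x, (∑ j ∈ s, h (x j)) ^ 2 ∂(Measure.pi fun _ : ι => ν) = s.card * ∫ e, h e ^ 2 ∂ν := by
  induction s using Finset.induction_on with
  | empty => simp
  | insert i s hi ih =>
    have hS := bddMeas_sum_eval hh s
    have hi' : BddMeas fun x : ι → E => h (x i) := hh.comp (measurable_pi_apply i)
    have e : ∀ x : ι → E, (∑ j ∈ insert i s, h (x j)) ^ 2 =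
        (∑ j ∈ s, h (x j)) ^ 2 + 2 * ((∑ j ∈ s, h (x j)) ^ 1 * h (x i) ^ 1) + h (x i) ^ 2 := by
      intro x
      rw [Finset.sum_insert hi]
      ring
    simp only [e]
    rw [integral_add, integral_add, integral_const_mul, integral_sum_pow_mul_pow ν hh.1 hi,
      integral_pi_eval ν (hh.1.pow_const 2), ih, Finset.card_insert_of_notMem hi]
    · simp [h0]
      ring
    · exact (hS.pow 2).integrable _
    · exact ((BddMeas.const 2).mul ((hS.pow 1).mul (hi'.pow 1))).integrable _
    · exact ((hS.pow 2).add ((BddMeas.const 2).mul ((hS.pow 1).mul (hi'.pow 1)))).integrable _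
    · exact (hi'.pow 2).integrable _

lemma integral_sum_pow_four_le (hh : BddMeas h) (h0 : ∫ e, h e ∂ν = 0) {B : ℝ}
    (hB : ∀ e, |h e| ≤ B) (s : Finset ι) :
    ∫ x, (∑ j ∈ s, h (x j)) ^ 4 ∂(Measure.pi fun _ : ι => ν) ≤ 3 * (s.card : ℝ) ^ 2 * B ^ 4 := by
  have hle : ∀ k, ∫ e, h e ^ (2 * k) ∂ν ≤ B ^ (2 * k) := by
    intro k
    have := integral_mono ((hh.pow (2 * k)).integrable ν) (integrable_const (B ^ (2 * k)))
      fun e => show h e ^ (2 * k) ≤ B ^ (2 * k) by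
        rw [pow_mul, pow_mul, ← sq_abs]
        have := hB e
        gcongr
    simpa using this
  induction s using Finset.induction_on with
  | empty => simp
  | insert i s hi ih =>
    have hS := bddMeas_sum_eval hh s
    have hi' : BddMeas fun x : ι → E => h (x i) := hh.comp (measurable_pi_apply i)
    have hT : ∀ (a : ℝ) (j l : ℕ), BddMeas fun x : ι → E =>
        a * ((∑ j ∈ s, h (x j)) ^ j * h (x i) ^ l) :=
      fun a j l => (BddMeas.const a).mul ((hS.pow j).mul (hi'.pow l))
    have e : ∀ x : ι → E, (∑ j ∈ insert i s, h (x j)) ^ 4 =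
        (∑ j ∈ s, h (x j)) ^ 4 + 4 * ((∑ j ∈ s, h (x j)) ^ 3 * h (x i) ^ 1)
        + 6 * ((∑ j ∈ s, h (x j)) ^ 2 * h (x i) ^ 2)
        + 4 * ((∑ j ∈ s, h (x j)) ^ 1 * h (x i) ^ 3) + h (x i) ^ 4 := by
      intro x
      rw [Finset.sum_insert hi]
      ring
    simp only [e]
    rw [integral_add, integral_add, integral_add, integral_add, integral_const_mul,
      integral_const_mul, integral_const_mul, integral_sum_pow_mul_pow ν hh.1 hi,
      integral_sum_pow_mul_pow ν hh.1 hi, integral_sum_pow_mul_pow ν hh.1 hi,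
      integral_pi_eval ν (hh.1.pow_const 4), integral_sum_sq ν hh h0,
      Finset.card_insert_of_notMem hi]
    · have h2 := hle 1
      have h4 := hle 2
      have h2' : 0 ≤ ∫ e, h e ^ 2 ∂ν := integral_nonneg fun _ => sq_nonneg _
      have hz := integral_sum_eq_zero ν hh h0 s
      simp only [mul_one, pow_one, hz, h0, zero_mul, mul_zero, add_zero] at h2 ⊢
      norm_num at h4
      push_cast
      have h22 : (s.card : ℝ) * (∫ e, h e ^ 2 ∂ν) * (∫ e, h e ^ 2 ∂ν) ≤
          s.card * (B ^ 2 * B ^ 2) := by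
        rw [mul_assoc]
        gcongr
      nlinarith [h22, h4, ih, sq_nonneg (B ^ 2)]
    · exact (hS.pow 4).integrable _
    · exact (hT 4 3 1).integrable _
    · exact ((hS.pow 4).add (hT 4 3 1)).integrable _
    · exact (hT 6 2 2).integrable _
    · exact (((hS.pow 4).add (hT 4 3 1)).add (hT 6 2 2)).integrable _
    · exact (hT 4 1 3).integrable _
    · exact ((((hS.pow 4).add (hT 4 3 1)).add (hT 6 2 2)).add (hT 4 1 3)).integrable _
    · exact (hi'.pow 4).integrable _

end Moments

section FeynmanKac

variable {M0 : Measure X} {M : ℕ → Kernel X X} {G : ℕ → X → ℝ}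

/-- The semigroup step `f ↦ G_p · M_{p+1}(f)`. -/
def fkStep (M : ℕ → Kernel X X) (G : ℕ → X → ℝ) (p : ℕ) (f : X → ℝ) : X → ℝ :=
  fun x => G p x * ∫ y, f y ∂(M (p + 1) x)

lemma BddMeas.fkStep [∀ p, IsMarkovKernel (M p)] {p : ℕ} {f : X → ℝ} (hG : BddMeas (G p))
    (hf : BddMeas f) : BddMeas (fkStep M G p f) :=
  hG.mul (BddMeas.integral_family (M (p + 1)).measurable (fun _ => inferInstance) hf)

lemma isFiniteMeasure_withDensity_of_bddMeas {μ : Measure X} [IsFiniteMeasure μ] {g : X → ℝ}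
    (hg : BddMeas g) : IsFiniteMeasure (μ.withDensity fun x => ENNReal.ofReal (g x)) :=
  isFiniteMeasure_withDensity_ofReal (hg.integrable μ).2

lemma isFiniteMeasure_gammaFK [IsProbabilityMeasure M0] [∀ p, IsMarkovKernel (M p)] {k : ℕ}
    (hG : ∀ p < k, BddMeas (G p)) : IsFiniteMeasure (gammaFK M0 M G k) := by
  induction k with
  | zero => exact inferInstanceAs (IsFiniteMeasure M0)
  | succ k ih =>
    have := ih fun p hp => hG p (hp.trans k.lt_succ_self)
    have := isFiniteMeasure_withDensity_of_bddMeas (μ := gammaFK M0 M G k) (hG k k.lt_succ_self)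
    refine ⟨?_⟩
    rw [gammaFK, Measure.bind_apply .univ (M (k + 1)).measurable.aemeasurable]
    simp only [measure_univ, lintegral_const, one_mul]
    exact measure_lt_top _ _

lemma gInt_succ [IsProbabilityMeasure M0] [∀ p, IsMarkovKernel (M p)] {k : ℕ}
    (hG : ∀ p ≤ k, BddMeas (G p)) (hpos : ∀ x, 0 < G k x) {f : X → ℝ} (hf : BddMeas f) :
    gInt M0 M G (k + 1) f = gInt M0 M G k (fkStep M G k f) := by
  have := isFiniteMeasure_gammaFK (M0 := M0) (M := M) (G := G) (k := k) fun p hp => hG p hp.le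
  have := isFiniteMeasure_withDensity_of_bddMeas (μ := gammaFK M0 M G k) (hG k le_rfl)
  rw [gInt, gammaFK, integral_bind (M (k + 1)).measurable (fun _ => inferInstance) hf,
    integral_withDensity_eq_integral_toReal_smul (hG k le_rfl).1.ennreal_ofReal
      (ae_of_all _ fun _ => ENNReal.ofReal_lt_top)]
  simp only [ENNReal.toReal_ofReal (hpos _).le, smul_eq_mul]
  rfl

lemma gInt_pos [IsProbabilityMeasure M0] [∀ p, IsMarkovKernel (M p)] {k : ℕ}
    (hG : ∀ p < k, BddMeas (G p)) (hpos : ∀ p < k, ∀ x, 0 < G p x) {f : X → ℝ}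
    (hf : BddMeas f) (hf0 : ∀ x, 0 < f x) : 0 < gInt M0 M G k f := by
  induction k generalizing f with
  | zero =>
    rw [gInt, gammaFK, integral_pos_iff_support_of_nonneg (fun x => (hf0 x).le) (hf.integrable _)]
    have : Function.support f = Set.univ := by
      ext x
      simp [(hf0 x).ne']
    simp [this]
  | succ k ih =>
    rw [gInt_succ (fun p hp => hG p (by omega)) (hpos k k.lt_succ_self) hf]
    refine ih (fun p hp => hG p (by omega)) (fun p hp => hpos p (by omega))
      ((hG k k.lt_succ_self).fkStep hf) fun x => mul_pos (hpos k k.lt_succ_self x) ?_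
    rw [integral_pos_iff_support_of_nonneg (fun x => (hf0 x).le) (hf.integrable _)]
    have : Function.support f = Set.univ := by
      ext x
      simp [(hf0 x).ne']
    simp [this]

lemma gInt_sub [IsProbabilityMeasure M0] [∀ p, IsMarkovKernel (M p)] {k : ℕ}
    (hG : ∀ p < k, BddMeas (G p)) {f g : X → ℝ} (hf : BddMeas f) (hg : BddMeas g) :
    gInt M0 M G k (fun x => f x - g x) = gInt M0 M G k f - gInt M0 M G k g := by
  have := isFiniteMeasure_gammaFK (M0 := M0) (M := M) hG
  exact integral_sub (hf.integrable _) (hg.integrable _)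

lemma gInt_const_mul (k : ℕ) (a : ℝ) (f : X → ℝ) :
    gInt M0 M G k (fun x => a * f x) = a * gInt M0 M G k f :=
  integral_const_mul _ _

end FeynmanKac

section MarkovPath

variable {Y : Type*} [MeasurableSpace Y] {μ0 : Measure Y} {κ : ℕ → Y → Measure Y}

lemma measurable_update_pair (k : ℕ) :
    Measurable fun q : (ℕ → Y) × Y => Function.update q.1 k q.2 := by
  refine measurable_pi_iff.2 fun i => ?_
  by_cases h : i = k
  · subst h
    simpa using measurable_snd
  · simp only [Function.update_of_ne h]
    fun_prop

lemma measurable_markovPath_step (hκ : ∀ p, Measurable (κ p))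
    (hp : ∀ p y, IsProbabilityMeasure (κ p y)) (k : ℕ) :
    Measurable fun ω : ℕ → Y => (κ (k + 1) (ω k)).map fun y => Function.update ω (k + 1) y :=
  measurable_map_family (κ := fun ω : ℕ → Y => κ (k + 1) (ω k))
    ((hκ (k + 1)).comp (measurable_pi_apply k)) (fun _ => hp _ _) (measurable_update_pair (k + 1))

lemma isProbabilityMeasure_markovPath_step (hp : ∀ p y, IsProbabilityMeasure (κ p y)) (k : ℕ)
    (ω : ℕ → Y) :
    IsProbabilityMeasure ((κ (k + 1) (ω k)).map fun y => Function.update ω (k + 1) y) := by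
  have := hp (k + 1) (ω k)
  exact Measure.isProbabilityMeasure_map (by fun_prop)

lemma isProbabilityMeasure_markovPath [IsProbabilityMeasure μ0] (hκ : ∀ p, Measurable (κ p))
    (hp : ∀ p y, IsProbabilityMeasure (κ p y)) (k : ℕ) :
    IsProbabilityMeasure (markovPath μ0 κ k) := by
  induction k with
  | zero => exact Measure.isProbabilityMeasure_map (by fun_prop)
  | succ k ih =>
    exact isProbabilityMeasure_bind (measurable_markovPath_step hκ hp k)
      (isProbabilityMeasure_markovPath_step hp k)

lemma integral_markovPath_succ [IsProbabilityMeasure μ0] (hκ : ∀ p, Measurable (κ p))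
    (hp : ∀ p y, IsProbabilityMeasure (κ p y)) {k : ℕ} {w : ℕ → Y → ℝ}
    (hw : ∀ p ≤ k, BddMeas (w p)) {F : Y → ℝ} (hF : BddMeas F) :
    ∫ ω, F (ω (k + 1)) * ∏ p ∈ Finset.range (k + 1), w p (ω p) ∂(markovPath μ0 κ (k + 1)) =
      ∫ ω, (w k (ω k) * ∫ y, F y ∂(κ (k + 1) (ω k))) * ∏ p ∈ Finset.range k, w p (ω p)
        ∂(markovPath μ0 κ k) := by
  have := isProbabilityMeasure_markovPath (μ0 := μ0) hκ hp k
  have hb : BddMeas fun ω : ℕ → Y =>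
      F (ω (k + 1)) * ∏ p ∈ Finset.range (k + 1), w p (ω p) :=
    (hF.comp (measurable_pi_apply _)).mul (BddMeas.prod _ fun p hp =>
      (hw p (by simpa [Nat.lt_succ_iff] using hp)).comp (measurable_pi_apply _))
  rw [markovPath, integral_bind (measurable_markovPath_step hκ hp k)
    (isProbabilityMeasure_markovPath_step hp k) hb]
  refine integral_congr_ae (ae_of_all _ fun ω => ?_)
  dsimp only
  rw [integral_map (by fun_prop) hb.1.aestronglyMeasurable]
  have e : ∀ y, ∏ p ∈ Finset.range (k + 1), w p (Function.update ω (k + 1) y p) =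
      ∏ p ∈ Finset.range (k + 1), w p (ω p) := fun y =>
    Finset.prod_congr rfl fun p hp => by
      rw [Function.update_of_ne (by simp at hp; omega)]
  simp only [e, Function.update_self, integral_mul_const, Finset.prod_range_succ]
  ring

end MarkovPath

section PairChain

variable {M0 : Measure X} {M : ℕ → Kernel X X} {G : ℕ → X → ℝ}

lemma isProbabilityMeasure_pairInit [IsProbabilityMeasure M0] (b : ℕ → Bool) :
    IsProbabilityMeasure (pairInit M0 b) := by
  unfold pairInit
  split_ifs
  · exact Measure.isProbabilityMeasure_map (by fun_prop)
  · infer_instance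

lemma isProbabilityMeasure_pairKer [∀ p, IsMarkovKernel (M p)] (b : ℕ → Bool) (p : ℕ)
    (q : X × X) : IsProbabilityMeasure (pairKer M b p q) := by
  unfold pairKer
  split_ifs
  · exact Measure.isProbabilityMeasure_map (by fun_prop)
  · infer_instance

lemma measurable_pairKer [∀ p, IsMarkovKernel (M p)] (b : ℕ → Bool) (p : ℕ) :
    Measurable (pairKer M b p) := by
  unfold pairKer
  split_ifs with h
  · exact measurable_map_family (κ := fun q : X × X => M p q.1)
      ((M p).measurable.comp measurable_fst) (fun _ => inferInstance)
      (g := fun _ y => (y, y)) (by fun_prop)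
  · have := (((M p).comap Prod.fst measurable_fst) ×ₖ
      ((M p).comap (Prod.snd : X × X → X) measurable_snd)).measurable
    convert this using 1
    funext q
    simp [Kernel.prod_apply]

lemma muB_zero_time (b : ℕ → Bool) {F : X × X → ℝ} (hF : BddMeas F) :
    muB M0 M G 0 b F = ∫ q, F q ∂(pairInit M0 b) := by
  rw [muB, markovPath, integral_map (by fun_prop)
    (by simpa using (hF.comp (measurable_pi_apply 0)).1.aestronglyMeasurable)]
  simp

lemma muB_succ [IsProbabilityMeasure M0] [∀ p, IsMarkovKernel (M p)] {k : ℕ}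
    (hG : ∀ p ≤ k, BddMeas (G p)) (b : ℕ → Bool) {F : X × X → ℝ} (hF : BddMeas F) :
    muB M0 M G (k + 1) b F = muB M0 M G k b fun q =>
      (G k q.1 * G k q.2) * ∫ y, F y ∂(pairKer M b (k + 1) q) := by
  have := isProbabilityMeasure_pairInit (M0 := M0) b
  exact integral_markovPath_succ (μ0 := pairInit M0 b) (measurable_pairKer b)
    (isProbabilityMeasure_pairKer b) (w := fun p q => G p q.1 * G p q.2)
    (fun p hp => ((hG p hp).comp measurable_fst).mul ((hG p hp).comp measurable_snd)) hF

lemma BddMeas.mul_prod {f g : X → ℝ} (hf : BddMeas f) (hg : BddMeas g) :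
    BddMeas fun q : X × X => f q.1 * g q.2 :=
  (hf.comp measurable_fst).mul (hg.comp measurable_snd)

lemma muB_succ_of_false [IsProbabilityMeasure M0] [∀ p, IsMarkovKernel (M p)] {k : ℕ}
    (hG : ∀ p ≤ k, BddMeas (G p)) {b : ℕ → Bool} (hb : b (k + 1) = false) {f g : X → ℝ}
    (hf : BddMeas f) (hg : BddMeas g) :
    muB M0 M G (k + 1) b (fun q => f q.1 * g q.2) =
      muB M0 M G k b fun q => fkStep M G k f q.1 * fkStep M G k g q.2 := by
  rw [muB_succ hG b (hf.mul_prod hg)]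
  congr 1
  funext q
  simp only [pairKer, hb, Bool.false_eq_true, if_false, integral_prod_mul, fkStep]
  ring

lemma muB_succ_of_true [IsProbabilityMeasure M0] [∀ p, IsMarkovKernel (M p)] {k : ℕ}
    (hG : ∀ p ≤ k, BddMeas (G p)) {b : ℕ → Bool} (hb : b (k + 1) = true) {f g : X → ℝ}
    (hf : BddMeas f) (hg : BddMeas g) :
    muB M0 M G (k + 1) b (fun q => f q.1 * g q.2) =
      muB M0 M G k b fun q => fkStep M G k (fun x => f x * g x) q.1 * G k q.2 := by
  rw [muB_succ hG b (hf.mul_prod hg)]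
  congr 1
  funext q
  simp only [pairKer, hb, if_true, fkStep]
  rw [integral_map (by fun_prop) (hf.mul_prod hg).1.aestronglyMeasurable]
  ring

lemma muB_eq_mul_gInt [IsProbabilityMeasure M0] [∀ p, IsMarkovKernel (M p)] {k : ℕ}
    (hG : ∀ p < k, BddMeas (G p)) (hpos : ∀ p < k, ∀ x, 0 < G p x) {b : ℕ → Bool}
    (hb : ∀ p ≤ k, b p = false) {f g : X → ℝ} (hf : BddMeas f) (hg : BddMeas g) :
    muB M0 M G k b (fun q => f q.1 * g q.2) = gInt M0 M G k f * gInt M0 M G k g := by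
  induction k generalizing f g with
  | zero =>
    rw [muB_zero_time b (hf.mul_prod hg)]
    simp only [pairInit, hb 0 le_rfl, Bool.false_eq_true, if_false, integral_prod_mul]
    rfl
  | succ k ih =>
    have hG' : ∀ p ≤ k, BddMeas (G p) := fun p hp => hG p (by omega)
    rw [muB_succ_of_false hG' (hb _ le_rfl) hf hg,
      ih (fun p hp => hG p (by omega)) (fun p hp => hpos p (by omega))
        (fun p hp => hb p (by omega)) ((hG' k le_rfl).fkStep hf) ((hG' k le_rfl).fkStep hg),
      gInt_succ hG' (hpos k k.lt_succ_self) hf, gInt_succ hG' (hpos k k.lt_succ_self) hg]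

/-- The unnormalized asymptotic variance `Σ_{p ≤ k} c_p⁻¹ (μ_{e_p}(f ⊗ f) − μ_0(f ⊗ f))`. -/
def asympVar (M0 : Measure X) (M : ℕ → Kernel X X) (G : ℕ → X → ℝ) (c : ℕ → ℝ) (k : ℕ)
    (f : X → ℝ) : ℝ :=
  ∑ p ∈ Finset.range (k + 1),
    (c p)⁻¹ * (muB M0 M G k (eVec p) (tens f) - muB M0 M G k zeroVec (tens f))

lemma sum_vpn_eq (c : ℕ → ℝ) (k : ℕ) (f : X → ℝ) :
    ∑ p ∈ Finset.range (k + 1), (c p)⁻¹ * vpn M0 M G k p f =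
      asympVar M0 M G c k f / gInt M0 M G k 1 ^ 2 := by
  simp only [asympVar, vpn, Finset.sum_div, mul_div_assoc]

lemma asympVar_zero [IsProbabilityMeasure M0] (c : ℕ → ℝ) {f : X → ℝ} (hf : BddMeas f) :
    asympVar M0 M G c 0 f = (c 0)⁻¹ * (∫ x, f x ^ 2 ∂M0 - (∫ x, f x ∂M0) ^ 2) := by
  have h : BddMeas (tens f) := hf.mul_prod hf
  simp only [asympVar, zero_add, Finset.sum_range_one, muB_zero_time _ h, pairInit, eVec, zeroVec,
    beq_self_eq_true, if_true, Bool.false_eq_true, if_false]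
  rw [integral_map (by fun_prop) h.1.aestronglyMeasurable]
  simp only [tens, integral_prod_mul, sq]

lemma asympVar_succ [IsProbabilityMeasure M0] [∀ p, IsMarkovKernel (M p)] {k : ℕ}
    (hG : ∀ p ≤ k, BddMeas (G p)) (hpos : ∀ p ≤ k, ∀ x, 0 < G p x) (c : ℕ → ℝ) {f : X → ℝ}
    (hf : BddMeas f) :
    asympVar M0 M G c (k + 1) f = asympVar M0 M G c k (fkStep M G k f) + (c (k + 1))⁻¹ *
      (gInt M0 M G k (G k) * gInt M0 M G k (fkStep M G k fun x => f x ^ 2) -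
        gInt M0 M G k (fkStep M G k f) ^ 2) := by
  have hlt : ∀ p < k, BddMeas (G p) := fun p hp => hG p hp.le
  have hQ : BddMeas (fkStep M G k f) := (hG k le_rfl).fkStep hf
  have hz : muB M0 M G (k + 1) zeroVec (tens f) =
      muB M0 M G k zeroVec (tens (fkStep M G k f)) := muB_succ_of_false hG rfl hf hf
  rw [asympVar, Finset.sum_range_succ, asympVar, hz]
  congr 1
  · refine Finset.sum_congr rfl fun p hp => ?_
    have hb : eVec p (k + 1) = false := by
      simp only [Finset.mem_range] at hp
      simp only [eVec, beq_eq_false_iff_ne]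
      omega
    have := muB_succ_of_false (M0 := M0) (M := M) hG hb hf hf
    unfold tens
    rw [this]
  · congr 2
    · have hb : eVec (k + 1) (k + 1) = true := by simp [eVec]
      have := muB_succ_of_true (M0 := M0) (M := M) hG hb hf hf
      unfold tens
      rw [this, muB_eq_mul_gInt hlt (fun p hp => hpos p hp.le) (fun p hp => by
        simp only [eVec, beq_eq_false_iff_ne]; omega) ((hG k le_rfl).fkStep (hf.mul hf))
        (hG k le_rfl), mul_comm]
      simp only [sq]
    · rw [sq]
      exact muB_eq_mul_gInt hlt (fun p hp => hpos p hp.le) (fun p hp => rfl) hQ hQ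

end PairChain

section IidMean

lemma affine_mean_eq {E : Type*} {g : E → ℝ} {m : ℕ} (hm : 0 < m) (Γ a t : ℝ) (x : Fin m → E) :
    Γ * ((m : ℝ)⁻¹ * ∑ i, g (x i)) - a = (Γ * t - a) + Γ * (m : ℝ)⁻¹ * ∑ i, (g (x i) - t) := by
  have : (m : ℝ) ≠ 0 := by positivity
  simp only [Finset.sum_sub_distrib, Finset.sum_const, Finset.card_univ, Fintype.card_fin,
    nsmul_eq_mul]
  field_simp
  ring

lemma add_pow_four_le (a b : ℝ) : (a + b) ^ 4 ≤ 8 * a ^ 4 + 8 * b ^ 4 := by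
  have h1 : (a + b) ^ 2 ≤ 2 * (a ^ 2 + b ^ 2) := by nlinarith [sq_nonneg (a - b)]
  have h2 : ((a + b) ^ 2) ^ 2 ≤ (2 * (a ^ 2 + b ^ 2)) ^ 2 := by gcongr
  nlinarith [sq_nonneg (a ^ 2 - b ^ 2)]

variable {E : Type*} [MeasurableSpace E] (ν : Measure E) [IsProbabilityMeasure ν]
  {g : E → ℝ} {m : ℕ}

lemma integral_sub_integral_eq_zero (hg : BddMeas g) : ∫ e, (g e - ∫ e, g e ∂ν) ∂ν = 0 := by
  rw [hg.integral_sub (BddMeas.const _)]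
  simp

lemma integral_affine_mean (hg : BddMeas g) (hm : 0 < m) (Γ : ℝ) :
    ∫ x, Γ * ((m : ℝ)⁻¹ * ∑ i, g (x i)) ∂(Measure.pi fun _ : Fin m => ν) =
      Γ * ∫ e, g e ∂ν := by
  have hh : BddMeas fun e => g e - ∫ e, g e ∂ν := hg.sub (BddMeas.const _)
  have e := affine_mean_eq (g := g) hm Γ 0 (∫ e, g e ∂ν)
  simp only [sub_zero] at e
  simp only [e]
  rw [(BddMeas.const _).integral_add ((BddMeas.const _).mul (bddMeas_sum_eval hh _)),
    integral_const_mul (Γ * (m : ℝ)⁻¹),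
    integral_sum_eq_zero ν hh (integral_sub_integral_eq_zero ν hg)]
  simp

lemma integral_affine_mean_sq (hg : BddMeas g) (hm : 0 < m) (Γ a : ℝ) :
    ∫ x, (Γ * ((m : ℝ)⁻¹ * ∑ i, g (x i)) - a) ^ 2 ∂(Measure.pi fun _ : Fin m => ν) =
      (Γ * ∫ e, g e ∂ν - a) ^ 2 +
        (m : ℝ)⁻¹ * (Γ ^ 2 * (∫ e, g e ^ 2 ∂ν - (∫ e, g e ∂ν) ^ 2)) := by
  set t := ∫ e, g e ∂ν with ht
  have hh : BddMeas fun e => g e - t := hg.sub (BddMeas.const _)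
  have h0 : ∫ e, (g e - t) ∂ν = 0 := integral_sub_integral_eq_zero ν hg
  have hS : BddMeas fun x : Fin m → E => ∑ i, (g (x i) - t) := bddMeas_sum_eval hh _
  have hvar : ∫ e, (g e - t) ^ 2 ∂ν = ∫ e, g e ^ 2 ∂ν - t ^ 2 := by
    have e : ∀ y, (g y - t) ^ 2 = g y ^ 2 - (2 * t * g y - t ^ 2) := fun y => by ring
    simp only [e]
    rw [(hg.pow 2).integral_sub (((BddMeas.const (2 * t)).mul hg).sub (BddMeas.const (t ^ 2))),
      ((BddMeas.const (2 * t)).mul hg).integral_sub (BddMeas.const (t ^ 2)),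
      integral_const_mul, ← ht]
    simp
    ring
  have e : ∀ x : Fin m → E, (Γ * ((m : ℝ)⁻¹ * ∑ i, g (x i)) - a) ^ 2 =
      (Γ * t - a) ^ 2 + (2 * (Γ * t - a) * (Γ * (m : ℝ)⁻¹)) * ∑ i, (g (x i) - t) +
        (Γ * (m : ℝ)⁻¹) ^ 2 * (∑ i, (g (x i) - t)) ^ 2 := fun x => by
    rw [affine_mean_eq hm Γ a t]
    ring
  simp only [e]
  rw [((BddMeas.const _).add ((BddMeas.const _).mul hS)).integral_add
      ((BddMeas.const _).mul (hS.pow 2)),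
    (BddMeas.const _).integral_add ((BddMeas.const _).mul hS),
    integral_const_mul, integral_const_mul, integral_sum_eq_zero ν hh h0,
    integral_sum_sq ν hh h0, hvar]
  have : (m : ℝ) ≠ 0 := by positivity
  simp
  field_simp

lemma integral_affine_mean_pow_four_le (hg : BddMeas g) {B : ℝ} (hB : ∀ e, |g e| ≤ B)
    (hm : 0 < m) (Γ a : ℝ) :
    ∫ x, (Γ * ((m : ℝ)⁻¹ * ∑ i, g (x i)) - a) ^ 4 ∂(Measure.pi fun _ : Fin m => ν) ≤
      8 * (Γ * ∫ e, g e ∂ν - a) ^ 4 + ((m : ℝ) ^ 2)⁻¹ * (24 * Γ ^ 4 * (2 * B) ^ 4) := by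
  set t := ∫ e, g e ∂ν with ht
  have hh : BddMeas fun e => g e - t := hg.sub (BddMeas.const _)
  have h0 : ∫ e, (g e - t) ∂ν = 0 := integral_sub_integral_eq_zero ν hg
  have hS : BddMeas fun x : Fin m → E => ∑ i, (g (x i) - t) := bddMeas_sum_eval hh _
  have htB : |t| ≤ B := by
    have := norm_integral_le_of_norm_le_const (μ := ν) (f := g) (C := B) (ae_of_all _ hB)
    simpa using this
  have hhB : ∀ e, |g e - t| ≤ 2 * B := fun e => (abs_sub _ _).trans (by linarith [hB e])
  have h4 := integral_sum_pow_four_le ν hh h0 hhB (Finset.univ : Finset (Fin m))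
  have hle : ∀ x : Fin m → E, (Γ * ((m : ℝ)⁻¹ * ∑ i, g (x i)) - a) ^ 4 ≤
      8 * (Γ * t - a) ^ 4 + 8 * (Γ * (m : ℝ)⁻¹) ^ 4 * (∑ i, (g (x i) - t)) ^ 4 := fun x => by
    rw [affine_mean_eq hm Γ a t]
    refine (add_pow_four_le _ _).trans_eq ?_
    ring
  have hgS : BddMeas fun x : Fin m → E => ∑ i, g (x i) := bddMeas_sum_eval hg _
  refine (BddMeas.integral_mono
    ((((BddMeas.const Γ).mul ((BddMeas.const _).mul hgS)).sub (BddMeas.const a)).pow 4)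
    ((BddMeas.const _).add ((BddMeas.const _).mul (hS.pow 4))) hle _).trans ?_
  rw [(BddMeas.const _).integral_add ((BddMeas.const _).mul (hS.pow 4)),
    integral_const_mul (8 * (Γ * (m : ℝ)⁻¹) ^ 4)]
  simp only [integral_const, probReal_univ, one_smul, Finset.card_univ, Fintype.card_fin] at h4 ⊢
  have hm' : (0 : ℝ) < m := by positivity
  have : 8 * (Γ * (m : ℝ)⁻¹) ^ 4 * (3 * (m : ℝ) ^ 2 * (2 * B) ^ 4) =
      ((m : ℝ) ^ 2)⁻¹ * (24 * Γ ^ 4 * (2 * B) ^ 4) := by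
    field_simp
    ring
  rw [← this]
  gcongr

end IidMean

section ParticleStep

variable {M0 : Measure X} {M : ℕ → Kernel X X} {G : ℕ → X → ℝ} {Np : ℕ → ℕ}

lemma sum_ofReal_cat {m : ℕ} {w : ℕ → ℝ} (hw : ∀ j, 0 < w j) :
    ∑ j ∈ Finset.range m, ENNReal.ofReal (w j) =
      ENNReal.ofReal (∑ j ∈ Finset.range m, w j) :=
  (ENNReal.ofReal_sum_of_nonneg fun j _ => (hw j).le).symm

lemma sum_range_pos {m : ℕ} (hm : 0 < m) {w : ℕ → ℝ} (hw : ∀ j, 0 < w j) :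
    0 < ∑ j ∈ Finset.range m, w j :=
  Finset.sum_pos (fun j _ => hw j) ⟨0, by simpa using hm⟩

lemma isProbabilityMeasure_cat {m : ℕ} (hm : 0 < m) {w : ℕ → ℝ} (hw : ∀ j, 0 < w j) :
    IsProbabilityMeasure (cat m w) := by
  refine ⟨?_⟩
  simp only [cat, Measure.smul_apply, Measure.finsetSum_apply, measure_univ, smul_eq_mul, mul_one]
  refine ENNReal.inv_mul_cancel ?_ ?_
  · rw [sum_ofReal_cat hw]
    simpa using sum_range_pos hm hw
  · rw [sum_ofReal_cat hw]
    exact ENNReal.ofReal_ne_top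

lemma integral_cat (m : ℕ) {w : ℕ → ℝ} (hw : ∀ j, 0 < w j) (f : ℕ → ℝ) :
    ∫ j, f j ∂(cat m w) =
      (∑ j ∈ Finset.range m, w j)⁻¹ * ∑ j ∈ Finset.range m, w j * f j := by
  have hnn : 0 ≤ ∑ j ∈ Finset.range m, w j := Finset.sum_nonneg fun j _ => (hw j).le
  rw [cat, integral_smul_measure, sum_ofReal_cat hw,
    integral_finsetSum_measure fun j _ => (integrable_dirac (by simp)).smul_measure (by simp)]
  simp [integral_smul_measure, ENNReal.toReal_ofReal hnn, ENNReal.toReal_ofReal (hw _).le]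

lemma measurable_cat (m : ℕ) {g : X → ℝ} (hg : Measurable g) :
    Measurable fun z : ℕ → X => cat m fun j => g (z j) := by
  refine Measure.measurable_of_measurable_coe _ fun s _ => ?_
  simp only [cat, Measure.smul_apply, Measure.finsetSum_apply, smul_eq_mul]
  fun_prop

lemma measurable_bind_family {A B D : Type*} [MeasurableSpace A] [MeasurableSpace B]
    [MeasurableSpace D] {κ : A → Measure B} (hκ : Measurable κ)
    (hp : ∀ a, IsProbabilityMeasure (κ a)) {η : A × B → Measure D} (hη : Measurable η) :
    Measurable fun a => (κ a).bind fun b => η (a, b) := by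
  let κ' : Kernel A B := ⟨κ, hκ⟩
  have : IsMarkovKernel κ' := ⟨hp⟩
  refine Measure.measurable_of_measurable_coe _ fun s hs => ?_
  have h : ∀ a, (κ a).bind (fun b => η (a, b)) s = ∫⁻ b, η (a, b) s ∂κ' a := fun a =>
    Measure.bind_apply hs (hη.comp measurable_prodMk_left).aemeasurable
  simp only [h]
  exact Measurable.lintegral_kernel_prod_right ((Measure.measurable_coe hs).comp hη)

/-- The conditional law of one (ancestor, particle) pair of generation `p + 1` given the
configuration `z` of generation `p`. -/
def offspringLaw (M : ℕ → Kernel X X) (G : ℕ → X → ℝ) (Np : ℕ → ℕ) (p : ℕ) (z : ℕ → X) :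
    Measure (ℕ × X) :=
  (cat (Np p) fun j => G p (z j)).bind fun a => (M (p + 1) (z a)).map fun x => (a, x)

lemma measurable_offspring_move (p : ℕ) [∀ p, IsMarkovKernel (M p)] :
    Measurable fun q : (ℕ → X) × ℕ => (M (p + 1) (q.1 q.2)).map fun x => (q.2, x) := by
  refine measurable_map_family (κ := fun q : (ℕ → X) × ℕ => M (p + 1) (q.1 q.2)) ?_
    (fun _ => inferInstance) (g := fun q x => (q.2, x)) (by fun_prop)
  refine (M (p + 1)).measurable.comp (measurable_from_prod_countable_left fun a => ?_)
  exact measurable_pi_apply a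

lemma isProbabilityMeasure_offspringLaw [∀ p, IsMarkovKernel (M p)] {p : ℕ} (hN : 0 < Np p)
    (hpos : ∀ x, 0 < G p x) (z : ℕ → X) : IsProbabilityMeasure (offspringLaw M G Np p z) := by
  have := isProbabilityMeasure_cat hN fun j => hpos (z j)
  exact isProbabilityMeasure_bind (measurable_of_countable _)
    fun a => Measure.isProbabilityMeasure_map (by fun_prop)

lemma measurable_offspringLaw [∀ p, IsMarkovKernel (M p)] {p : ℕ} (hN : 0 < Np p)
    (hG : Measurable (G p)) (hpos : ∀ x, 0 < G p x) : Measurable (offspringLaw M G Np p) := by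
  have h := measurable_bind_family (measurable_cat (Np p) hG)
    (fun z => isProbabilityMeasure_cat hN fun j => hpos (z j))
    (measurable_offspring_move (M := M) p)
  exact h

lemma integral_offspringLaw [∀ p, IsMarkovKernel (M p)] {p : ℕ} (hN : 0 < Np p)
    (hpos : ∀ x, 0 < G p x) (z : ℕ → X) {f : X → ℝ} (hf : BddMeas f) :
    ∫ q, f q.2 ∂(offspringLaw M G Np p z) =
      (∑ j ∈ Finset.range (Np p), G p (z j))⁻¹ *
        ∑ j ∈ Finset.range (Np p), fkStep M G p f (z j) := by
  have := isProbabilityMeasure_cat hN fun j => hpos (z j)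
  have hf2 : BddMeas fun q : ℕ × X => f q.2 := hf.comp measurable_snd
  rw [offspringLaw, integral_bind (measurable_of_countable _)
    (fun a => Measure.isProbabilityMeasure_map (by fun_prop)) hf2,
    integral_cat _ fun j => hpos (z j)]
  congr 1
  refine Finset.sum_congr rfl fun j _ => ?_
  rw [integral_map (by fun_prop) hf2.1.aestronglyMeasurable]
  rfl

lemma measurable_padF {Y : Type*} [MeasurableSpace Y] [Nonempty Y] {m : ℕ} :
    Measurable (padF : (Fin m → Y) → ℕ → Y) := by
  refine measurable_pi_iff.2 fun i => ?_
  by_cases h : i < m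
  · simpa [padF, h] using measurable_pi_apply (⟨i, h⟩ : Fin m)
  · simp [padF, h]

lemma sum_range_padF {Y : Type*} [Nonempty Y] {m : ℕ} (x : Fin m → Y) (f : Y → ℝ) :
    ∑ i ∈ Finset.range m, f (padF x i) = ∑ i, f (x i) := by
  rw [Finset.sum_range]
  simp [padF]

/-- The state `(ζ, A)` extended by one generation with (ancestor, particle) pairs `y`. -/
def extendState [Nonempty X] {m : ℕ} (k : ℕ) (ω : (ℕ → ℕ → X) × (ℕ → ℕ → ℕ))
    (y : Fin m → ℕ × X) : (ℕ → ℕ → X) × (ℕ → ℕ → ℕ) :=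
  (Function.update ω.1 (k + 1) (padF fun i => (y i).2),
    Function.update ω.2 k (padF fun i => (y i).1))

lemma measurable_extendState [Nonempty X] {m : ℕ} (k : ℕ) :
    Measurable fun q : ((ℕ → ℕ → X) × (ℕ → ℕ → ℕ)) × (Fin m → ℕ × X) =>
      extendState k q.1 q.2 := by
  have h1 : Measurable fun q : ((ℕ → ℕ → X) × (ℕ → ℕ → ℕ)) × (Fin m → ℕ × X) =>
      fun i => (q.2 i).1 := by fun_prop
  have h2 : Measurable fun q : ((ℕ → ℕ → X) × (ℕ → ℕ → ℕ)) × (Fin m → ℕ × X) =>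
      fun i => (q.2 i).2 := by fun_prop
  refine Measurable.prodMk ?_ ?_
  · exact (measurable_update_pair (k + 1)).comp
      ((measurable_fst.comp measurable_fst).prodMk (measurable_padF.comp h2))
  · exact (measurable_update_pair k).comp
      ((measurable_snd.comp measurable_fst).prodMk (measurable_padF.comp h1))

lemma pfLaw_succ [Nonempty X] (k : ℕ) :
    pfLaw M0 M G Np (k + 1) = (pfLaw M0 M G Np k).bind fun ω =>
      (Measure.pi fun _ : Fin (Np (k + 1)) => offspringLaw M G Np k (ω.1 k)).map
        (extendState k ω) := by
  rw [pfLaw]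
  congr 1
  funext ω
  rw [pfStep, Measure.map_map]
  · rfl
  · refine Measurable.prodMk ?_ ?_
    · exact (measurable_update_pair (k + 1)).comp (measurable_const.prodMk measurable_snd)
    · exact (measurable_update_pair k).comp (measurable_const.prodMk measurable_fst)
  · exact (measurable_padF.comp (by fun_prop)).prodMk (measurable_padF.comp (by fun_prop))

lemma isProbabilityMeasure_pfLaw_step [Nonempty X] [∀ p, IsMarkovKernel (M p)] {k : ℕ}
    (hN : 0 < Np k) (hpos : ∀ x, 0 < G k x) (ω : (ℕ → ℕ → X) × (ℕ → ℕ → ℕ)) :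
    IsProbabilityMeasure ((Measure.pi fun _ : Fin (Np (k + 1)) =>
      offspringLaw M G Np k (ω.1 k)).map (extendState k ω)) := by
  have := isProbabilityMeasure_offspringLaw (M := M) hN hpos (ω.1 k)
  exact Measure.isProbabilityMeasure_map
    ((measurable_extendState k).comp (measurable_prodMk_left (x := ω))).aemeasurable

lemma measurable_pfLaw_step [Nonempty X] [∀ p, IsMarkovKernel (M p)] {k : ℕ}
    (hN : 0 < Np k) (hG : Measurable (G k)) (hpos : ∀ x, 0 < G k x) :
    Measurable fun ω : (ℕ → ℕ → X) × (ℕ → ℕ → ℕ) => (Measure.pi fun _ : Fin (Np (k + 1)) =>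
      offspringLaw M G Np k (ω.1 k)).map (extendState k ω) := by
  have hp := isProbabilityMeasure_offspringLaw (M := M) (Np := Np) hN hpos
  refine measurable_map_family (κ := fun ω : (ℕ → ℕ → X) × (ℕ → ℕ → ℕ) =>
    Measure.pi fun _ : Fin (Np (k + 1)) => offspringLaw M G Np k (ω.1 k)) ?_
    (fun ω => by have := hp (ω.1 k); infer_instance) (measurable_extendState k)
  exact measurable_pi_family ((measurable_offspringLaw hN hG hpos).comp
    ((measurable_pi_apply k).comp measurable_fst)) fun ω => hp (ω.1 k)

lemma isProbabilityMeasure_pfLaw [Nonempty X] [IsProbabilityMeasure M0]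
    [∀ p, IsMarkovKernel (M p)] {k : ℕ} (hN : ∀ p ≤ k, 0 < Np p) (hG : ∀ p ≤ k, Measurable (G p))
    (hpos : ∀ p ≤ k, ∀ x, 0 < G p x) : IsProbabilityMeasure (pfLaw M0 M G Np k) := by
  induction k with
  | zero =>
    refine Measure.isProbabilityMeasure_map (Measurable.aemeasurable ?_)
    refine Measurable.prodMk (measurable_pi_iff.2 fun p => ?_) measurable_const
    by_cases h : p = 0
    · simpa [h] using measurable_padF
    · simp [h]
  | succ k ih =>
    have := ih (fun p hp => hN p (by omega)) (fun p hp => hG p (by omega))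
      (fun p hp => hpos p (by omega))
    rw [pfLaw_succ]
    exact isProbabilityMeasure_bind
      (measurable_pfLaw_step (hN k (by omega)) (hG k (by omega)) (hpos k (by omega)))
      (isProbabilityMeasure_pfLaw_step (hN k (by omega)) (hpos k (by omega)))

lemma integral_pfLaw_zero [Nonempty X] [IsProbabilityMeasure M0]
    {Ψ : (ℕ → ℕ → X) × (ℕ → ℕ → ℕ) → ℝ} (hΨ : BddMeas Ψ) :
    ∫ ω, Ψ ω ∂(pfLaw M0 M G Np 0) = ∫ x, Ψ (fun p => if p = 0 then padF x else
      fun _ => Classical.arbitrary X, fun _ _ => 0) ∂(Measure.pi fun _ : Fin (Np 0) => M0) := by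
  rw [pfLaw, integral_map _ hΨ.1.aestronglyMeasurable]
  refine Measurable.aemeasurable ?_
  refine Measurable.prodMk (measurable_pi_iff.2 fun p => ?_) measurable_const
  by_cases h : p = 0
  · simpa [h] using measurable_padF
  · simp [h]

lemma integral_pfLaw_succ [Nonempty X] [IsProbabilityMeasure M0]
    [∀ p, IsMarkovKernel (M p)] {k : ℕ} (hN : ∀ p ≤ k, 0 < Np p) (hG : ∀ p ≤ k, Measurable (G p))
    (hpos : ∀ p ≤ k, ∀ x, 0 < G p x) {Ψ : (ℕ → ℕ → X) × (ℕ → ℕ → ℕ) → ℝ} (hΨ : BddMeas Ψ) :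
    ∫ ω, Ψ ω ∂(pfLaw M0 M G Np (k + 1)) = ∫ ω, ∫ y, Ψ (extendState k ω y)
      ∂(Measure.pi fun _ : Fin (Np (k + 1)) => offspringLaw M G Np k (ω.1 k))
        ∂(pfLaw M0 M G Np k) := by
  have := isProbabilityMeasure_pfLaw (M0 := M0) (M := M) hN hG hpos
  rw [pfLaw_succ, integral_bind
    (measurable_pfLaw_step (hN k le_rfl) (hG k le_rfl) (hpos k le_rfl))
    (isProbabilityMeasure_pfLaw_step (hN k le_rfl) (hpos k le_rfl)) hΨ]
  refine integral_congr_ae (ae_of_all _ fun ω => ?_)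
  exact integral_map ((measurable_extendState k).comp
    (measurable_prodMk_left (x := ω))).aemeasurable hΨ.1.aestronglyMeasurable

end ParticleStep

section ParticleMoments

variable {M0 : Measure X} {M : ℕ → Kernel X X} {G : ℕ → X → ℝ} {Np : ℕ → ℕ}

lemma abs_etaN_le {Y : Type*} {f : Y → ℝ} {C : ℝ} (hC0 : 0 ≤ C) (hC : ∀ x, |f x| ≤ C)
    (Np : ℕ → ℕ) (k : ℕ) (ω : (ℕ → ℕ → Y) × (ℕ → ℕ → ℕ)) : |etaN Np k f ω| ≤ C := by
  rw [etaN, abs_mul, abs_inv, Nat.abs_cast]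
  rcases Nat.eq_zero_or_pos (Np k) with h | h
  · simpa [h] using hC0
  · rw [inv_mul_le_iff₀ (by positivity)]
    refine (Finset.abs_sum_le_sum_abs _ _).trans ?_
    simpa using Finset.sum_le_sum fun i (_ : i ∈ Finset.range (Np k)) => hC (ω.1 k i)

lemma BddMeas.etaN {f : X → ℝ} (hf : BddMeas f) (Np : ℕ → ℕ) (k : ℕ) :
    BddMeas (PFVar.etaN Np k f) :=
  (BddMeas.const _).mul (BddMeas.sum _ fun i _ =>
    hf.comp ((measurable_pi_apply i).comp ((measurable_pi_apply k).comp measurable_fst)))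

lemma BddMeas.gammaN {k : ℕ} (hG : ∀ p < k, BddMeas (G p)) {f : X → ℝ} (hf : BddMeas f)
    (Np : ℕ → ℕ) : BddMeas (PFVar.gammaN G Np k f) :=
  (BddMeas.prod _ fun p hp => (hG p (Finset.mem_range.1 hp)).etaN Np p).mul (hf.etaN Np k)

lemma exists_abs_gammaN_le {k : ℕ} (hG : ∀ p < k, BddMeas (G p)) {f : X → ℝ} (hf : BddMeas f) :
    ∃ C, ∀ Np ω, |gammaN G Np k f ω| ≤ C := by
  have h : ∀ p, ∃ C, p < k → 0 ≤ C ∧ ∀ x, |G p x| ≤ C := fun p => by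
    by_cases hp : p < k
    · exact (hG p hp).exists_nonneg.imp fun _ hC _ => hC
    · exact ⟨0, fun h => absurd h hp⟩
  choose D hD using h
  obtain ⟨C, hC0, hC⟩ := hf.exists_nonneg
  refine ⟨(∏ p ∈ Finset.range k, D p) * C, fun Np ω => ?_⟩
  rw [gammaN, abs_mul, Finset.abs_prod]
  have hD' : ∀ p ∈ Finset.range k, 0 ≤ D p ∧ ∀ x, |G p x| ≤ D p :=
    fun p hp => hD p (Finset.mem_range.1 hp)
  refine mul_le_mul ?_ (abs_etaN_le hC0 hC Np k ω) (abs_nonneg _)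
    (Finset.prod_nonneg fun p hp => (hD' p hp).1)
  exact Finset.prod_le_prod (fun _ _ => abs_nonneg _)
    fun p hp => abs_etaN_le (hD' p hp).1 (hD' p hp).2 Np p ω

lemma gammaN_extendState {Y : Type*} [Nonempty Y] {G : ℕ → Y → ℝ} (k : ℕ) (f : Y → ℝ)
    (ω : (ℕ → ℕ → Y) × (ℕ → ℕ → ℕ)) (y : Fin (Np (k + 1)) → ℕ × Y) :
    gammaN G Np (k + 1) f (extendState k ω y) =
      gammaN G Np k (G k) ω * ((Np (k + 1) : ℝ)⁻¹ * ∑ i, f (y i).2) := by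
  have h1 : ∏ p ∈ Finset.range (k + 1), etaN Np p (G p) (extendState k ω y) =
      gammaN G Np k (G k) ω := by
    rw [gammaN, ← Finset.prod_range_succ (fun p => etaN Np p (G p) ω)]
    refine Finset.prod_congr rfl fun p hp => ?_
    have : p ≠ k + 1 := (Finset.mem_range.1 hp).ne
    simp [etaN, extendState, this]
  rw [gammaN, h1, etaN]
  congr 2
  simpa [extendState] using sum_range_padF (fun i => (y i).2) f

lemma gammaN_mul_integral_offspringLaw [∀ p, IsMarkovKernel (M p)] {k : ℕ} (hN : 0 < Np k)
    (hpos : ∀ x, 0 < G k x) (ω : (ℕ → ℕ → X) × (ℕ → ℕ → ℕ)) {f : X → ℝ} (hf : BddMeas f) :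
    gammaN G Np k (G k) ω * ∫ q, f q.2 ∂(offspringLaw M G Np k (ω.1 k)) =
      gammaN G Np k (fkStep M G k f) ω := by
  have hS := (sum_range_pos hN fun j => hpos (ω.1 k j)).ne'
  rw [integral_offspringLaw hN hpos _ hf, gammaN, gammaN, etaN, etaN]
  field_simp

variable [Nonempty X] [IsProbabilityMeasure M0]

lemma integral_gammaN [∀ p, IsMarkovKernel (M p)] {k : ℕ} (hN : ∀ p ≤ k, 0 < Np p)
    (hG : ∀ p ≤ k, BddMeas (G p)) (hpos : ∀ p ≤ k, ∀ x, 0 < G p x) {f : X → ℝ} (hf : BddMeas f) :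
    ∫ ω, gammaN G Np k f ω ∂(pfLaw M0 M G Np k) = gInt M0 M G k f := by
  induction k generalizing f with
  | zero =>
    rw [integral_pfLaw_zero (hf.gammaN (by simp) Np)]
    have h := integral_affine_mean M0 hf (hN 0 le_rfl) 1
    simp only [one_mul] at h
    simpa [gammaN, etaN, sum_range_padF, gInt, gammaFK] using h
  | succ k ih =>
    rw [integral_pfLaw_succ (fun p hp => hN p (by omega)) (fun p hp => (hG p (by omega)).1)
      (fun p hp => hpos p (by omega)) (hf.gammaN (fun p hp => hG p hp.le) Np),
      gInt_succ (fun p hp => hG p (by omega)) (hpos k (by omega)) hf,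
      ← ih (fun p hp => hN p (by omega)) (fun p hp => hG p (by omega))
        (fun p hp => hpos p (by omega)) ((hG k (by omega)).fkStep hf)]
    refine integral_congr_ae (ae_of_all _ fun ω => ?_)
    have := isProbabilityMeasure_offspringLaw (M := M) (hN k (by omega)) (hpos k (by omega)) (ω.1 k)
    simp only [gammaN_extendState]
    rw [integral_affine_mean (offspringLaw M G Np k (ω.1 k)) (g := fun q : ℕ × X => f q.2)
      (hf.comp measurable_snd) (hN (k + 1) le_rfl),
      gammaN_mul_integral_offspringLaw (hN k (by omega)) (hpos k (by omega)) ω hf]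

lemma integral_gammaN_zero_sub_sq (hN : 0 < Np 0) {f : X → ℝ} (hf : BddMeas f) :
    ∫ ω, (gammaN G Np 0 f ω - gInt M0 M G 0 f) ^ 2 ∂(pfLaw M0 M G Np 0) =
      (Np 0 : ℝ)⁻¹ * (∫ x, f x ^ 2 ∂M0 - (∫ x, f x ∂M0) ^ 2) := by
  rw [integral_pfLaw_zero (((hf.gammaN (by simp) Np).sub (BddMeas.const _)).pow 2)]
  have h := integral_affine_mean_sq M0 hf hN 1 (gInt M0 M G 0 f)
  simp only [one_mul, one_pow] at h
  have h0 : ∫ x, f x ∂M0 - gInt M0 M G 0 f = 0 := sub_self _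
  rw [h0] at h
  simpa [gammaN, etaN, sum_range_padF] using h

lemma integral_gammaN_succ_sub_sq [∀ p, IsMarkovKernel (M p)] {k : ℕ}
    (hN : ∀ p ≤ k + 1, 0 < Np p)
    (hG : ∀ p ≤ k, BddMeas (G p)) (hpos : ∀ p ≤ k, ∀ x, 0 < G p x) {f : X → ℝ}
    (hf : BddMeas f) :
    ∫ ω, (gammaN G Np (k + 1) f ω - gInt M0 M G (k + 1) f) ^ 2 ∂(pfLaw M0 M G Np (k + 1)) =
      ∫ ω, (gammaN G Np k (fkStep M G k f) ω - gInt M0 M G k (fkStep M G k f)) ^ 2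
          ∂(pfLaw M0 M G Np k) +
        (Np (k + 1) : ℝ)⁻¹ *
          (∫ ω, gammaN G Np k (G k) ω * gammaN G Np k (fkStep M G k fun x => f x ^ 2) ω
              ∂(pfLaw M0 M G Np k) -
            ∫ ω, gammaN G Np k (fkStep M G k f) ω * gammaN G Np k (fkStep M G k f) ω
              ∂(pfLaw M0 M G Np k)) := by
  have hN' : ∀ p ≤ k, 0 < Np p := fun p hp => hN p (by omega)
  have hlt : ∀ p < k, BddMeas (G p) := fun p hp => hG p hp.le
  have := isProbabilityMeasure_pfLaw (M0 := M0) (M := M) hN' (fun p hp => (hG p hp).1) hpos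
  have hg := (hG k le_rfl).gammaN hlt Np
  have h1 := (BddMeas.fkStep (M := M) (hG k le_rfl) hf).gammaN hlt Np
  have h2 := (BddMeas.fkStep (M := M) (hG k le_rfl) (hf.pow 2)).gammaN hlt Np
  rw [integral_pfLaw_succ hN' (fun p hp => (hG p hp).1) hpos
    (((hf.gammaN (fun p hp => hG p (by omega)) Np).sub (BddMeas.const _)).pow 2),
    gInt_succ hG (hpos k le_rfl) hf, ← (hg.mul h2).integral_sub (h1.mul h1),
    ← integral_const_mul, ← ((h1.sub (BddMeas.const _)).pow 2).integral_add
      ((BddMeas.const _).mul ((hg.mul h2).sub (h1.mul h1)))]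
  refine integral_congr_ae (ae_of_all _ fun ω => ?_)
  have := isProbabilityMeasure_offspringLaw (M := M) (hN' k le_rfl) (hpos k le_rfl) (ω.1 k)
  simp only [gammaN_extendState]
  rw [integral_affine_mean_sq (offspringLaw M G Np k (ω.1 k)) (g := fun q : ℕ × X => f q.2)
    (hf.comp measurable_snd) (hN (k + 1) le_rfl),
    ← gammaN_mul_integral_offspringLaw (hN' k le_rfl) (hpos k le_rfl) ω hf,
    ← gammaN_mul_integral_offspringLaw (hN' k le_rfl) (hpos k le_rfl) ω (hf.pow 2)]
  ring

lemma integral_gammaN_zero_sub_pow_four_le {f : X → ℝ} (hf : BddMeas f) :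
    ∃ K, 0 ≤ K ∧ ∀ Np : ℕ → ℕ, 0 < Np 0 →
      ∫ ω, (gammaN G Np 0 f ω - gInt M0 M G 0 f) ^ 4 ∂(pfLaw M0 M G Np 0) ≤
        ((Np 0 : ℝ) ^ 2)⁻¹ * K := by
  obtain ⟨B, hB⟩ := hf.2
  refine ⟨24 * (2 * B) ^ 4, by positivity, fun Np hN => ?_⟩
  rw [integral_pfLaw_zero (((hf.gammaN (by simp) Np).sub (BddMeas.const _)).pow 4)]
  have h := integral_affine_mean_pow_four_le M0 hf hB hN 1 (gInt M0 M G 0 f)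
  simp only [one_mul, one_pow, mul_one] at h
  have h0 : ∫ x, f x ∂M0 - gInt M0 M G 0 f = 0 := sub_self _
  rw [h0] at h
  simpa [gammaN, etaN, sum_range_padF] using h

lemma integral_gammaN_succ_sub_pow_four_le [∀ p, IsMarkovKernel (M p)] {k : ℕ}
    (hG : ∀ p ≤ k, BddMeas (G p)) (hpos : ∀ p ≤ k, ∀ x, 0 < G p x) {f : X → ℝ}
    (hf : BddMeas f) : ∃ K, 0 ≤ K ∧ ∀ Np : ℕ → ℕ, (∀ p ≤ k + 1, 0 < Np p) →
      ∫ ω, (gammaN G Np (k + 1) f ω - gInt M0 M G (k + 1) f) ^ 4 ∂(pfLaw M0 M G Np (k + 1)) ≤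
        8 * ∫ ω, (gammaN G Np k (fkStep M G k f) ω - gInt M0 M G k (fkStep M G k f)) ^ 4
          ∂(pfLaw M0 M G Np k) + ((Np (k + 1) : ℝ) ^ 2)⁻¹ * K := by
  have hlt : ∀ p < k, BddMeas (G p) := fun p hp => hG p hp.le
  obtain ⟨B, hB⟩ := hf.2
  obtain ⟨C, hC⟩ := exists_abs_gammaN_le hlt (hG k le_rfl)
  refine ⟨24 * C ^ 4 * (2 * B) ^ 4, by positivity, fun Np hN => ?_⟩
  have hN' : ∀ p ≤ k, 0 < Np p := fun p hp => hN p (by omega)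
  have := isProbabilityMeasure_pfLaw (M0 := M0) (M := M) hN' (fun p hp => (hG p hp).1) hpos
  have hg := (hG k le_rfl).gammaN hlt Np
  have h1 := (BddMeas.fkStep (M := M) (hG k le_rfl) hf).gammaN hlt Np
  have h4 := (h1.sub (BddMeas.const (gInt M0 M G k (fkStep M G k f)))).pow 4
  rw [integral_pfLaw_succ hN' (fun p hp => (hG p hp).1) hpos
    (((hf.gammaN (fun p hp => hG p (by omega)) Np).sub (BddMeas.const _)).pow 4),
    gInt_succ hG (hpos k le_rfl) hf]
  have hbound : ∫ ω, (8 * (gammaN G Np k (fkStep M G k f) ω - gInt M0 M G k (fkStep M G k f)) ^ 4 +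
        ((Np (k + 1) : ℝ) ^ 2)⁻¹ * (24 * C ^ 4 * (2 * B) ^ 4)) ∂(pfLaw M0 M G Np k) =
      8 * ∫ ω, (gammaN G Np k (fkStep M G k f) ω - gInt M0 M G k (fkStep M G k f)) ^ 4
          ∂(pfLaw M0 M G Np k) + ((Np (k + 1) : ℝ) ^ 2)⁻¹ * (24 * C ^ 4 * (2 * B) ^ 4) := by
    rw [((BddMeas.const 8).mul h4).integral_add (BddMeas.const _), integral_const_mul]
    simp
  rw [← hbound]
  refine integral_mono_of_nonneg (ae_of_all _ fun ω => integral_nonneg fun y => by positivity)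
    ((((BddMeas.const 8).mul h4).add (BddMeas.const _)).integrable _) (ae_of_all _ fun ω => ?_)
  have := isProbabilityMeasure_offspringLaw (M := M) (hN' k le_rfl) (hpos k le_rfl) (ω.1 k)
  simp only [gammaN_extendState]
  refine (integral_affine_mean_pow_four_le (offspringLaw M G Np k (ω.1 k))
    (g := fun q : ℕ × X => f q.2) (hf.comp measurable_snd) (fun q => hB q.2)
    (hN (k + 1) le_rfl) _ _).trans ?_
  rw [gammaN_mul_integral_offspringLaw (hN' k le_rfl) (hpos k le_rfl) ω hf]
  have : gammaN G Np k (G k) ω ^ 4 ≤ C ^ 4 := by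
    rw [← Even.pow_abs (by decide : Even 4)]
    exact pow_le_pow_left₀ (abs_nonneg _) (hC Np ω) 4
  gcongr

end ParticleMoments

section Asymptotics

lemma npart_pos {c : ℕ → ℝ} {N p : ℕ} (hc : 0 < c p) (hN : 0 < N) : 0 < npart c N p :=
  Nat.ceil_pos.2 (by positivity)

lemma tendsto_mul_inv_npart {c : ℕ → ℝ} {p : ℕ} (hc : 0 < c p) :
    Tendsto (fun N : ℕ => (N : ℝ) * (npart c N p : ℝ)⁻¹) atTop (nhds (c p)⁻¹) := by
  have h := ((tendsto_nat_ceil_mul_div_atTop hc.le).comp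
    (tendsto_natCast_atTop_atTop (R := ℝ))).inv₀ hc.ne'
  refine h.congr fun N => ?_
  simp [npart, div_eq_mul_inv, mul_comm]

lemma mul_inv_npart_le {c : ℕ → ℝ} {N p : ℕ} (hc : 0 < c p) (hN : 0 < N) :
    (N : ℝ) * (npart c N p : ℝ)⁻¹ ≤ (c p)⁻¹ := by
  have h : c p * N ≤ npart c N p := Nat.le_ceil _
  have h0 : (0 : ℝ) < npart c N p := by exact_mod_cast npart_pos hc hN
  rw [mul_inv_le_iff₀ h0, ← div_eq_inv_mul, le_div_iff₀ hc]
  linarith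

lemma tendsto_zero_of_tendsto_natCast_mul {a : ℕ → ℝ} {σ : ℝ}
    (h : Tendsto (fun N : ℕ => (N : ℝ) * a N) atTop (nhds σ)) : Tendsto a atTop (nhds 0) := by
  have h' := (tendsto_inv_atTop_zero.comp (tendsto_natCast_atTop_atTop (R := ℝ))).mul h
  rw [zero_mul] at h'
  refine h'.congr' ?_
  filter_upwards [eventually_gt_atTop 0] with N hN
  have : (N : ℝ) ≠ 0 := by positivity
  simp only [Function.comp_apply]
  field_simp

section Generic

variable {Ω : Type*} [MeasurableSpace Ω] {P : ℕ → Measure Ω}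

lemma tendsto_integral_mul_of_tendsto_integral_sub_sq
    (hP : ∀ᶠ N in atTop, IsProbabilityMeasure (P N)) {U V : ℕ → Ω → ℝ} {u v : ℝ}
    (hU : ∀ N, BddMeas (U N)) (hV : ∀ N, BddMeas (V N))
    (hUm : ∀ᶠ N in atTop, ∫ ω, U N ω ∂P N = u) (hVm : ∀ᶠ N in atTop, ∫ ω, V N ω ∂P N = v)
    (hU2 : Tendsto (fun N => ∫ ω, (U N ω - u) ^ 2 ∂P N) atTop (nhds 0))
    (hV2 : Tendsto (fun N => ∫ ω, (V N ω - v) ^ 2 ∂P N) atTop (nhds 0)) :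
    Tendsto (fun N => ∫ ω, U N ω * V N ω ∂P N) atTop (nhds (u * v)) := by
  rw [tendsto_iff_norm_sub_tendsto_zero]
  refine squeeze_zero' (Eventually.of_forall fun _ => norm_nonneg _) ?_
    (by simpa using hU2.add hV2)
  filter_upwards [hP, hUm, hVm] with N _ hu hv
  have hU' := (hU N).sub (BddMeas.const u)
  have hV' := (hV N).sub (BddMeas.const v)
  have h : ∫ ω, U N ω * V N ω ∂P N - u * v = ∫ ω, (U N ω - u) * (V N ω - v) ∂P N := by
    have e : ∀ ω, (U N ω - u) * (V N ω - v) =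
        (U N ω * V N ω - u * V N ω) - (v * U N ω - u * v) := fun ω => by ring
    simp only [e]
    rw [(((hU N).mul (hV N)).sub ((BddMeas.const u).mul (hV N))).integral_sub
        (((BddMeas.const v).mul (hU N)).sub (BddMeas.const (u * v))),
      ((hU N).mul (hV N)).integral_sub ((BddMeas.const u).mul (hV N)),
      ((BddMeas.const v).mul (hU N)).integral_sub (BddMeas.const (u * v)),
      integral_const_mul, integral_const_mul, hu, hv]
    simp
    ring
  rw [h, ← (hU'.pow 2).integral_add (hV'.pow 2)]
  refine norm_integral_le_of_norm_le (((hU'.pow 2).add (hV'.pow 2)).integrable _)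
    (ae_of_all _ fun ω => ?_)
  rw [Real.norm_eq_abs, abs_le]
  constructor <;> nlinarith [sq_nonneg (U N ω - u + (V N ω - v)),
    sq_nonneg (U N ω - u - (V N ω - v))]

lemma abs_sq_sub_sq_le {δ : ℝ} (hδ : 0 < δ) (e u : ℝ) :
    |e ^ 2 - u ^ 2| ≤ δ * u ^ 2 + (1 + δ⁻¹) * (e - u) ^ 2 := by
  have h1 : 0 ≤ δ * (u + δ⁻¹ * (e - u)) ^ 2 := by positivity
  have h2 : 0 ≤ δ * (u - δ⁻¹ * (e - u)) ^ 2 := by positivity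
  have e1 : δ * (u + δ⁻¹ * (e - u)) ^ 2 = δ * u ^ 2 + 2 * u * (e - u) + δ⁻¹ * (e - u) ^ 2 := by
    field_simp
    ring
  have e2 : δ * (u - δ⁻¹ * (e - u)) ^ 2 = δ * u ^ 2 - 2 * u * (e - u) + δ⁻¹ * (e - u) ^ 2 := by
    field_simp
    ring
  rw [abs_le]
  constructor <;> nlinarith [sq_nonneg (e - u)]

lemma sub_mul_sq_le {e r K : ℝ} (he : |e| ≤ K) :
    (e - e * r) ^ 2 ≤ (e * r) ^ 4 + (1 + 2 * K ^ 2) * (r - 1) ^ 4 := by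
  have h1 : e ^ 2 ≤ K ^ 2 := sq_le_sq.2 (he.trans (le_abs_self K))
  have h2 : e - e * r = -(e * r * (r - 1)) + e * (r - 1) ^ 2 := by ring
  have h3 : e ^ 2 * (r - 1) ^ 4 ≤ K ^ 2 * (r - 1) ^ 4 := by gcongr
  rw [h2]
  nlinarith [sq_nonneg (e * r * (r - 1) + e * (r - 1) ^ 2),
    sq_nonneg ((e * r) ^ 2 - (r - 1) ^ 2)]

/-- If `u = e * r` with `e` bounded, `u` and `r - 1` of order `N ^ (-1/2)` in `L⁴`, then `e` and
`u` have the same rescaled second moment. -/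
lemma tendsto_natCast_mul_integral_sq_of_mul_eq
    (hP : ∀ᶠ N in atTop, IsProbabilityMeasure (P N)) {e u r : ℕ → Ω → ℝ} {K L L' σ : ℝ}
    (he : ∀ N, BddMeas (e N)) (hu : ∀ N, BddMeas (u N)) (hr : ∀ N, BddMeas (r N))
    (hK : ∀ N ω, |e N ω| ≤ K) (heq : ∀ᶠ N in atTop, ∀ ω, e N ω * r N ω = u N ω)
    (hu4 : ∀ᶠ N : ℕ in atTop, (N : ℝ) ^ 2 * ∫ ω, u N ω ^ 4 ∂P N ≤ L)
    (hr4 : ∀ᶠ N : ℕ in atTop, (N : ℝ) ^ 2 * ∫ ω, (r N ω - 1) ^ 4 ∂P N ≤ L')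
    (hu2 : Tendsto (fun N : ℕ => (N : ℝ) * ∫ ω, u N ω ^ 2 ∂P N) atTop (nhds σ)) :
    Tendsto (fun N : ℕ => (N : ℝ) * ∫ ω, e N ω ^ 2 ∂P N) atTop (nhds σ) := by
  have hsq : Tendsto (fun N : ℕ => (√(N : ℝ))⁻¹) atTop (nhds 0) :=
    tendsto_inv_atTop_zero.comp
      (Real.tendsto_sqrt_atTop.comp (tendsto_natCast_atTop_atTop (R := ℝ)))
  have hinv : Tendsto (fun N : ℕ => (N : ℝ)⁻¹) atTop (nhds 0) :=
    tendsto_inv_atTop_zero.comp (tendsto_natCast_atTop_atTop (R := ℝ))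
  have hlim := (hsq.mul hu2).add ((hinv.add hsq).mul_const (L + (1 + 2 * K ^ 2) * L'))
  rw [zero_mul, add_zero, zero_mul, add_zero] at hlim
  have hdiff : Tendsto (fun N : ℕ => (N : ℝ) * ∫ ω, (e N ω ^ 2 - u N ω ^ 2) ∂P N) atTop
      (nhds 0) := by
    refine squeeze_zero_norm' ?_ hlim
    filter_upwards [hP, heq, hu4, hr4, eventually_gt_atTop 0] with N _ hN h4 h4' h0
    have hN0 : (0 : ℝ) < N := by exact_mod_cast h0
    have hs0 : 0 < √(N : ℝ) := Real.sqrt_pos.2 hN0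
    have hs2 : √(N : ℝ) ^ 2 = N := Real.sq_sqrt hN0.le
    have hr' := ((hr N).sub (BddMeas.const 1)).pow 4
    have hu' := (hu N).pow 4
    have hd := ((he N).sub (hu N)).pow 2
    have hD : ∫ ω, (e N ω - u N ω) ^ 2 ∂P N ≤
        ∫ ω, u N ω ^ 4 ∂P N + (1 + 2 * K ^ 2) * ∫ ω, (r N ω - 1) ^ 4 ∂P N := by
      rw [← integral_const_mul, ← hu'.integral_add ((BddMeas.const _).mul hr')]
      refine hd.integral_mono (hu'.add ((BddMeas.const _).mul hr')) (fun ω => ?_) _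
      rw [← hN ω]
      exact sub_mul_sq_le (hK N ω)
    have hDN : (N : ℝ) ^ 2 * ∫ ω, (e N ω - u N ω) ^ 2 ∂P N ≤ L + (1 + 2 * K ^ 2) * L' := by
      calc (N : ℝ) ^ 2 * ∫ ω, (e N ω - u N ω) ^ 2 ∂P N
          ≤ (N : ℝ) ^ 2 * (∫ ω, u N ω ^ 4 ∂P N +
              (1 + 2 * K ^ 2) * ∫ ω, (r N ω - 1) ^ 4 ∂P N) := by gcongr
        _ = (N : ℝ) ^ 2 * ∫ ω, u N ω ^ 4 ∂P N +
              (1 + 2 * K ^ 2) * ((N : ℝ) ^ 2 * ∫ ω, (r N ω - 1) ^ 4 ∂P N) := by ring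
        _ ≤ L + (1 + 2 * K ^ 2) * L' := by gcongr
    have hE : ‖∫ ω, (e N ω ^ 2 - u N ω ^ 2) ∂P N‖ ≤
        (√(N : ℝ))⁻¹ * ∫ ω, u N ω ^ 2 ∂P N +
          (1 + √(N : ℝ)) * ∫ ω, (e N ω - u N ω) ^ 2 ∂P N := by
      have hu2' := (BddMeas.const (√(N : ℝ))⁻¹).mul ((hu N).pow 2)
      have hd' := (BddMeas.const (1 + √(N : ℝ))).mul hd
      rw [← integral_const_mul, ← integral_const_mul, ← hu2'.integral_add hd']
      refine norm_integral_le_of_norm_le ((hu2'.add hd').integrable _) (ae_of_all _ fun ω => ?_)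
      simpa using abs_sq_sub_sq_le (inv_pos.2 hs0) (e N ω) (u N ω)
    rw [norm_mul, Real.norm_natCast]
    calc (N : ℝ) * ‖∫ ω, (e N ω ^ 2 - u N ω ^ 2) ∂P N‖
        ≤ N * ((√(N : ℝ))⁻¹ * ∫ ω, u N ω ^ 2 ∂P N +
          (1 + √(N : ℝ)) * ∫ ω, (e N ω - u N ω) ^ 2 ∂P N) := by gcongr
      _ = (√(N : ℝ))⁻¹ * (N * ∫ ω, u N ω ^ 2 ∂P N) + ((N : ℝ)⁻¹ + (√(N : ℝ))⁻¹) *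
          ((N : ℝ) ^ 2 * ∫ ω, (e N ω - u N ω) ^ 2 ∂P N) := by
        generalize ∫ ω, (e N ω - u N ω) ^ 2 ∂P N = D
        generalize √(N : ℝ) = s at hs0 hs2
        rw [← hs2]
        field_simp
      _ ≤ _ := by gcongr
  have h := hdiff.add hu2
  rw [zero_add] at h
  refine h.congr' ?_
  filter_upwards [hP] with N _
  rw [((he N).pow 2).integral_sub ((hu N).pow 2)]
  ring

end Generic

variable {M0 : Measure X} {M : ℕ → Kernel X X} {G : ℕ → X → ℝ} [Nonempty X]
  [IsProbabilityMeasure M0] [∀ p, IsMarkovKernel (M p)] {c : ℕ → ℝ} {k : ℕ}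

lemma exists_sq_mul_integral_gammaN_sub_pow_four_le (hG : ∀ p ≤ k, BddMeas (G p))
    (hpos : ∀ p ≤ k, ∀ x, 0 < G p x) (hc : ∀ p ≤ k, 0 < c p) {f : X → ℝ} (hf : BddMeas f) :
    ∃ L, ∀ N : ℕ, 0 < N → (N : ℝ) ^ 2 *
      ∫ ω, (gammaN G (npart c N) k f ω - gInt M0 M G k f) ^ 4
        ∂(pfLaw M0 M G (npart c N) k) ≤ L := by
  have hle : ∀ p ≤ k, ∀ N : ℕ, 0 < N → ∀ K : ℝ, 0 ≤ K →
      (N : ℝ) ^ 2 * (((npart c N p : ℝ) ^ 2)⁻¹ * K) ≤ (c p)⁻¹ ^ 2 * K := by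
    intro p hp N hN K hK
    have := mul_inv_npart_le (hc p hp) hN
    rw [← mul_assoc, ← inv_pow, ← mul_pow]
    gcongr
  induction k generalizing f with
  | zero =>
    obtain ⟨K, hK0, hK⟩ := integral_gammaN_zero_sub_pow_four_le (M0 := M0) (M := M) (G := G) hf
    refine ⟨(c 0)⁻¹ ^ 2 * K, fun N hN => le_trans ?_ (hle 0 le_rfl N hN K hK0)⟩
    have := hK _ (npart_pos (hc 0 le_rfl) hN)
    gcongr
  | succ k ih =>
    have hG' : ∀ p ≤ k, BddMeas (G p) := fun p hp => hG p (by omega)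
    have hpos' : ∀ p ≤ k, ∀ x, 0 < G p x := fun p hp => hpos p (by omega)
    obtain ⟨K, hK0, hK⟩ := integral_gammaN_succ_sub_pow_four_le (M0 := M0) (M := M) hG' hpos' hf
    obtain ⟨L, hL⟩ := ih hG' hpos' (fun p hp => hc p (by omega))
      ((hG' k le_rfl).fkStep (M := M) hf) (fun p hp => hle p (by omega))
    refine ⟨8 * L + (c (k + 1))⁻¹ ^ 2 * K, fun N hN => ?_⟩
    have h1 := hK _ fun p hp => npart_pos (hc p hp) hN
    have h2 := mul_le_mul_of_nonneg_left h1 (by positivity : (0 : ℝ) ≤ (N : ℝ) ^ 2)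
    have h3 := hle (k + 1) le_rfl N hN K hK0
    have h4 := hL N hN
    linarith

lemma tendsto_natCast_mul_integral_gammaN_sub_sq (hG : ∀ p ≤ k, BddMeas (G p))
    (hpos : ∀ p ≤ k, ∀ x, 0 < G p x) (hc : ∀ p ≤ k, 0 < c p) {f : X → ℝ} (hf : BddMeas f) :
    Tendsto (fun N : ℕ => (N : ℝ) *
      ∫ ω, (gammaN G (npart c N) k f ω - gInt M0 M G k f) ^ 2 ∂(pfLaw M0 M G (npart c N) k))
      atTop (nhds (asympVar M0 M G c k f)) := by
  induction k generalizing f with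
  | zero =>
    rw [asympVar_zero c hf]
    refine ((tendsto_mul_inv_npart (hc 0 le_rfl)).mul_const _).congr' ?_
    filter_upwards [eventually_gt_atTop 0] with N hN
    rw [integral_gammaN_zero_sub_sq (npart_pos (hc 0 le_rfl) hN) hf, mul_assoc]
  | succ k ih =>
    have hG' : ∀ p ≤ k, BddMeas (G p) := fun p hp => hG p (by omega)
    have hlt : ∀ p < k, BddMeas (G p) := fun p hp => hG p (by omega)
    have hpos' : ∀ p ≤ k, ∀ x, 0 < G p x := fun p hp => hpos p (by omega)
    have hc' : ∀ p ≤ k, 0 < c p := fun p hp => hc p (by omega)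
    have hprod : ∀ g h : X → ℝ, BddMeas g → BddMeas h → Tendsto (fun N : ℕ =>
        ∫ ω, gammaN G (npart c N) k g ω * gammaN G (npart c N) k h ω
          ∂(pfLaw M0 M G (npart c N) k)) atTop
        (nhds (gInt M0 M G k g * gInt M0 M G k h)) := by
      intro g h hg hh
      refine tendsto_integral_mul_of_tendsto_integral_sub_sq ?_ (fun N => hg.gammaN hlt _)
        (fun N => hh.gammaN hlt _) ?_ ?_
        (tendsto_zero_of_tendsto_natCast_mul (ih hG' hpos' hc' hg))
        (tendsto_zero_of_tendsto_natCast_mul (ih hG' hpos' hc' hh))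
      · filter_upwards [eventually_gt_atTop 0] with N hN
        exact isProbabilityMeasure_pfLaw (fun p hp => npart_pos (hc' p hp) hN)
          (fun p hp => (hG' p hp).1) hpos'
      · filter_upwards [eventually_gt_atTop 0] with N hN
        exact integral_gammaN (fun p hp => npart_pos (hc' p hp) hN) hG' hpos' hg
      · filter_upwards [eventually_gt_atTop 0] with N hN
        exact integral_gammaN (fun p hp => npart_pos (hc' p hp) hN) hG' hpos' hh
    have hQ := (hG' k le_rfl).fkStep (M := M) hf
    have hQ2 := (hG' k le_rfl).fkStep (M := M) (hf.pow 2)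
    rw [asympVar_succ hG' hpos' c hf, sq (gInt M0 M G k (fkStep M G k f))]
    refine ((ih hG' hpos' hc' hQ).add ((tendsto_mul_inv_npart (hc (k + 1) le_rfl)).mul
      ((hprod _ _ (hG' k le_rfl) hQ2).sub (hprod _ _ hQ hQ)))).congr' ?_
    filter_upwards [eventually_gt_atTop 0] with N hN
    rw [integral_gammaN_succ_sub_sq (fun p hp => npart_pos (hc p hp) hN) hG' hpos' hf]
    ring

end Asymptotics

theorem statement8
    {X : Type*} [MeasurableSpace X] [Nonempty X] (hX : ∃ x y : X, x ≠ y) (n : ℕ)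
    (M0 : Measure X) [IsProbabilityMeasure M0]
    (M : ℕ → Kernel X X) [∀ p, IsMarkovKernel (M p)]
    (G : ℕ → X → ℝ) (hGm : ∀ p ≤ n, Measurable (G p))
    (hGpos : ∀ p ≤ n, ∀ x, 0 < G p x) (hGbd : ∀ p ≤ n, ∃ C, ∀ x, G p x ≤ C)
    (c : ℕ → ℝ) (hc : ∀ p ≤ n, 0 < c p)
    (φ : X → ℝ) (hφm : Measurable φ) (hφb : ∃ C, ∀ x, |φ x| ≤ C) :
    Tendsto (fun N : ℕ => (N : ℝ) *
        variance (fun ω => gammaN G (npart c N) n φ ω / gInt M0 M G n 1)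
          (pfLaw M0 M G (npart c N) n)) atTop
      (nhds (∑ p ∈ Finset.range (n + 1), (c p)⁻¹ * vpn M0 M G n p φ)) ∧
    Tendsto (fun N : ℕ => (N : ℝ) *
        ∫ ω, (etaN (npart c N) n φ ω - eInt M0 M G n φ) ^ 2
          ∂(pfLaw M0 M G (npart c N) n)) atTop
      (nhds (∑ p ∈ Finset.range (n + 1),
        (c p)⁻¹ * vpn M0 M G n p fun x => φ x - eInt M0 M G n φ)) := by
  have hG : ∀ p ≤ n, BddMeas (G p) := fun p hp => ⟨hGm p hp, (hGbd p hp).imp fun C hC x => by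
    rw [abs_of_pos (hGpos p hp x)]
    exact hC x⟩
  have hlt : ∀ p < n, BddMeas (G p) := fun p hp => hG p hp.le
  have hφ : BddMeas φ := ⟨hφm, hφb⟩
  have hone : BddMeas (1 : X → ℝ) := BddMeas.const 1
  have hnp : ∀ N : ℕ, 0 < N → ∀ p ≤ n, 0 < npart c N p :=
    fun N hN p hp => npart_pos (hc p hp) hN
  have hP : ∀ N : ℕ, 0 < N → IsProbabilityMeasure (pfLaw M0 M G (npart c N) n) :=
    fun N hN => isProbabilityMeasure_pfLaw (hnp N hN) hGm hGpos
  have hg : 0 < gInt M0 M G n 1 :=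
    gInt_pos hlt (fun p hp => hGpos p hp.le) hone fun _ => one_pos
  rw [sum_vpn_eq, sum_vpn_eq]
  have key : ∀ f : X → ℝ, BddMeas f → Tendsto (fun N : ℕ => (N : ℝ) *
      ∫ ω, (gammaN G (npart c N) n f ω / gInt M0 M G n 1 - gInt M0 M G n f / gInt M0 M G n 1) ^ 2
        ∂(pfLaw M0 M G (npart c N) n)) atTop
      (nhds (asympVar M0 M G c n f / gInt M0 M G n 1 ^ 2)) := by
    intro f hf
    refine ((tendsto_natCast_mul_integral_gammaN_sub_sq (M0 := M0) (M := M) hG hGpos hc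
      hf).div_const (gInt M0 M G n 1 ^ 2)).congr fun N => ?_
    simp only [← sub_div, div_pow, integral_div, mul_div_assoc]
  have key4 : ∀ f : X → ℝ, BddMeas f → ∃ L, ∀ᶠ N : ℕ in atTop, (N : ℝ) ^ 2 *
      ∫ ω, (gammaN G (npart c N) n f ω / gInt M0 M G n 1 - gInt M0 M G n f / gInt M0 M G n 1) ^ 4
        ∂(pfLaw M0 M G (npart c N) n) ≤ L := by
    intro f hf
    obtain ⟨L, hL⟩ := exists_sq_mul_integral_gammaN_sub_pow_four_le (M0 := M0) (M := M)
      hG hGpos hc hf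
    refine ⟨L / gInt M0 M G n 1 ^ 4, ?_⟩
    filter_upwards [eventually_gt_atTop 0] with N hN
    simp only [← sub_div, div_pow, integral_div, ← mul_div_assoc]
    have := hL N hN
    gcongr
  refine ⟨?_, ?_⟩
  · refine (key φ hφ).congr' ?_
    filter_upwards [eventually_gt_atTop 0] with N hN
    have hm := (hφ.gammaN hlt (npart c N)).1
    rw [variance_eq_integral (hm.div_const _).aemeasurable, integral_div,
      integral_gammaN (hnp N hN) hG hGpos hφ]
  · set ψ : X → ℝ := fun x => φ x - eInt M0 M G n φ with hψdef
    have hψ : BddMeas ψ := hφ.sub (BddMeas.const _)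
    have hψ0 : gInt M0 M G n ψ = 0 := by
      have h := gInt_const_mul (M0 := M0) (M := M) (G := G) n (eInt M0 M G n φ) 1
      simp only [Pi.one_apply, mul_one] at h
      rw [hψdef, gInt_sub hlt hφ (BddMeas.const _), h, eInt, div_mul_cancel₀ _ hg.ne', sub_self]
    obtain ⟨K, hK0, hK⟩ := hψ.exists_nonneg
    obtain ⟨L, hL⟩ := key4 ψ hψ
    obtain ⟨L', hL'⟩ := key4 1 hone
    have h2 := key ψ hψ
    simp only [hψ0, zero_div, sub_zero] at hL h2
    simp only [div_self hg.ne'] at hL'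
    have hdiv : ∀ f : X → ℝ, BddMeas f → ∀ N : ℕ,
        BddMeas fun ω => gammaN G (npart c N) n f ω / gInt M0 M G n 1 := fun f hf N => by
      simpa only [div_eq_mul_inv] using (hf.gammaN hlt (npart c N)).mul (BddMeas.const _)
    have hmain := tendsto_natCast_mul_integral_sq_of_mul_eq
      (eventually_gt_atTop 0 |>.mono hP) (fun N => hψ.etaN (npart c N) n) (hdiv ψ hψ)
      (hdiv 1 hone) (fun N ω => abs_etaN_le hK0 hK _ n ω) ?_ hL hL' h2
    · refine hmain.congr' ?_
      filter_upwards [eventually_gt_atTop 0] with N hN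
      have h0 : (npart c N n : ℝ) ≠ 0 := by exact_mod_cast (hnp N hN n le_rfl).ne'
      congr 1
      refine integral_congr_ae (ae_of_all _ fun ω => ?_)
      simp [hψdef, etaN, mul_sub, h0]
    · filter_upwards [eventually_gt_atTop 0] with N hN
      intro ω
      have h0 : (npart c N n : ℝ) ≠ 0 := by exact_mod_cast (hnp N hN n le_rfl).ne'
      have h1 : etaN (npart c N) n (1 : X → ℝ) ω = 1 := by simp [etaN, h0]
      rw [gammaN, gammaN, h1]
      ring
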